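/- arXiv:math/0310086 — 3 statements merged into one kernel-verified Lean document; each statement's English description precedes it below -/
import Mathlib

section
/- Let F be a rotation-invariant function on the space of real d×d symmetric matrices. If the restriction of F to the diagonal matrices is C^n, then F is C^n. -/
open Matrix

attribute [local instance] Matrix.frobeniusNormedAddCommGroup Matrix.frobeniusNormedSpace

/-- The space of real symmetric `d × d` matrices, as a submodule of the matrix space. -/
def SymMat (d : ℕ) : Submodule ℝ (Matrix (Fin d) (Fin d) ℝ) where
  carrier := {A | A.IsSymm}
  add_mem' := Matrix.IsSymm.add
  zero_mem' := Matrix.isSymm_zero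
  smul_mem' := fun c _ h => h.smul c

section

open Filter Topology Set
open scoped ContDiff

/-- The iterated directional derivative of `F` along the vectors of a list; the head of the list
is the outermost derivative. -/
noncomputable def dirDeriv {E : Type*} [NormedAddCommGroup E] [NormedSpace ℝ E] :
    List E → (E → ℝ) → E → ℝ
  | [], F => F
  | h :: L, F => fun x => fderiv ℝ (dirDeriv L F) x h

section DirDeriv

variable {E V : Type*} [NormedAddCommGroup E] [NormedSpace ℝ E]
  [NormedAddCommGroup V] [NormedSpace ℝ V]

theorem dirDeriv_eq_iteratedFDeriv {n : ℕ} {F : E → ℝ} (hF : ContDiff ℝ n F) (L : List E)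
    (hL : L.length ≤ n) (x : E) :
    dirDeriv L F x = iteratedFDeriv ℝ L.length F x L.get := by
  induction L generalizing x with
  | nil => simp [dirDeriv]
  | cons h L ih =>
    have hlt : L.length < n := by simpa using hL
    have hd : DifferentiableAt ℝ (iteratedFDeriv ℝ L.length F) x :=
      hF.differentiable_iteratedFDeriv (by exact_mod_cast hlt) x
    have h1 : dirDeriv L F = fun y => iteratedFDeriv ℝ L.length F y L.get :=
      funext (ih hlt.le)
    simp only [dirDeriv, h1, List.length_cons]
    rw [fderiv_continuousMultilinear_apply_const_apply hd, iteratedFDeriv_succ_apply_left]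
    rfl

theorem contDiff_dirDeriv {F : E → ℝ} (hF : ContDiff ℝ ∞ F) (L : List E) :
    ContDiff ℝ ∞ (dirDeriv L F) := by
  induction L with
  | nil => exact hF
  | cons h L ih => exact (ih.fderiv_right (m := ∞) (by simp)).clm_apply contDiff_const

theorem differentiable_dirDeriv {F : E → ℝ} (hF : ContDiff ℝ ∞ F) (L : List E) :
    Differentiable ℝ (dirDeriv L F) :=
  (contDiff_dirDeriv hF L).differentiable (by simp)

theorem contDiff_dirDeriv_of_length_add_le {n : ℕ} {F : E → ℝ} (hF : ContDiff ℝ n F) (L : List E)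
    {m : ℕ} (hL : L.length + m ≤ n) : ContDiff ℝ m (dirDeriv L F) := by
  induction L generalizing m with
  | nil => exact hF.of_le (by exact_mod_cast (by simpa using hL))
  | cons h L ih =>
    have := ih (m := m + 1) (by simp at hL; omega)
    exact (this.fderiv_right (m := m) (by simp)).clm_apply contDiff_const

theorem dirDeriv_append (L₁ L₂ : List E) (F : E → ℝ) :
    dirDeriv (L₁ ++ L₂) F = dirDeriv L₁ (dirDeriv L₂ F) := by
  induction L₁ with
  | nil => rfl
  | cons h L ih => simp only [List.cons_append, dirDeriv, ih]

theorem fderiv_dirDeriv_cons {F : E → ℝ} (hF : ContDiff ℝ ∞ F) (L : List E) (h k x : E) :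
    fderiv ℝ (dirDeriv (h :: L) F) x k = fderiv ℝ (fderiv ℝ (dirDeriv L F)) x k h := by
  have hd : DifferentiableAt ℝ (fderiv ℝ (dirDeriv L F)) x :=
    ((contDiff_dirDeriv hF L).fderiv_right (m := ∞) (by simp)).differentiable (by simp) x
  simp only [dirDeriv]
  rw [fderiv_clm_apply hd (differentiableAt_const h)]
  simp

theorem dirDeriv_swap {F : E → ℝ} (hF : ContDiff ℝ ∞ F) (L : List E) (h k : E) :
    dirDeriv (h :: k :: L) F = dirDeriv (k :: h :: L) F := by
  funext x
  change fderiv ℝ (dirDeriv (k :: L) F) x h = fderiv ℝ (dirDeriv (h :: L) F) x k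
  rw [fderiv_dirDeriv_cons hF, fderiv_dirDeriv_cons hF]
  have : IsSymmSndFDerivAt ℝ (dirDeriv L F) x :=
    (contDiff_dirDeriv hF L).contDiffAt.isSymmSndFDerivAt (by simpa using ENat.LEInfty.out)
  exact this h k

theorem dirDeriv_perm {F : E → ℝ} (hF : ContDiff ℝ ∞ F) {L L' : List E} (h : L.Perm L') :
    dirDeriv L F = dirDeriv L' F := by
  induction h with
  | nil => rfl
  | cons a _ ih => simp only [dirDeriv, ih]
  | swap a b L => exact dirDeriv_swap hF L b a
  | trans _ _ ih₁ ih₂ => exact ih₁.trans ih₂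

theorem dirDeriv_sub {F G : E → ℝ} (hF : ContDiff ℝ ∞ F) (hG : ContDiff ℝ ∞ G) (L : List E) :
    dirDeriv L (fun x => F x - G x) = fun x => dirDeriv L F x - dirDeriv L G x := by
  induction L with
  | nil => rfl
  | cons h L ih =>
    funext x
    simp only [dirDeriv, ih]
    rw [fderiv_fun_sub (differentiable_dirDeriv hF L x) (differentiable_dirDeriv hG L x)]
    rfl

theorem dirDeriv_sum {ι : Type*} {G : ι → E → ℝ} (hG : ∀ i, ContDiff ℝ ∞ (G i)) (s : Finset ι)
    (L : List E) :
    dirDeriv L (fun x => ∑ i ∈ s, G i x) = fun x => ∑ i ∈ s, dirDeriv L (G i) x := by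
  induction L with
  | nil => rfl
  | cons h L ih =>
    funext x
    simp only [dirDeriv, ih]
    rw [fderiv_fun_sum fun i _ => differentiable_dirDeriv (hG i) L x]
    simp

theorem dirDeriv_comp_linearMap [FiniteDimensional ℝ V] {F : E → ℝ} (hF : ContDiff ℝ ∞ F)
    (T : V →ₗ[ℝ] E) (L : List V) :
    dirDeriv L (fun x => F (T x)) = fun x => dirDeriv (L.map T) F (T x) := by
  induction L with
  | nil => rfl
  | cons h L ih =>
    funext x
    simp only [dirDeriv, ih, List.map_cons]
    have := ((differentiable_dirDeriv hF (L.map T) (T x)).hasFDerivAt.comp x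
      (LinearMap.toContinuousLinearMap T).hasFDerivAt).fderiv
    simp only [Function.comp_def] at this
    rw [this]
    rfl

theorem contDiff_comp_linearMap [FiniteDimensional ℝ V] {F : E → ℝ} (hF : ContDiff ℝ ∞ F)
    (T : V →ₗ[ℝ] E) : ContDiff ℝ ∞ fun x => F (T x) :=
  hF.comp (LinearMap.toContinuousLinearMap T).contDiff

theorem fderiv_eq_fderiv_of_forall_smul {G : E → ℝ} {A Y Z : E} (hG : DifferentiableAt ℝ G A)
    (h : ∀ t : ℝ, G (A + t • Y) = G (A + t • Z)) : fderiv ℝ G A Y = fderiv ℝ G A Z := by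
  have key : ∀ Y : E, HasDerivAt (fun t : ℝ => G (A + t • Y)) (fderiv ℝ G A Y) 0 := by
    intro Y
    have h1 : HasDerivAt (fun t : ℝ => A + t • Y) Y 0 := by
      simpa using ((hasDerivAt_id (0 : ℝ)).smul_const Y).const_add A
    have h2 : HasFDerivAt G (fderiv ℝ G A) (A + (0 : ℝ) • Y) := by
      simpa using hG.hasFDerivAt
    exact h2.comp_hasDerivAt 0 h1
  exact (key Y).unique (funext h ▸ key Z)

/-- If the linear vector field `T` annihilates `G`, its action on the iterated directional
derivatives of `G` is given by the action of `T` on the directions. -/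
theorem fderiv_dirDeriv_linearMap_apply_self [FiniteDimensional ℝ E] {G : E → ℝ}
    (hG : ContDiff ℝ ∞ G) (T : E →ₗ[ℝ] E) (hT : ∀ A, fderiv ℝ G A (T A) = 0) (L : List E)
    (A : E) :
    fderiv ℝ (dirDeriv L G) A (T A) =
      -∑ k ∈ Finset.range L.length, dirDeriv (L.modify k T) G A := by
  induction L generalizing A with
  | nil => simpa [dirDeriv] using hT A
  | cons H L ih =>
    have hd : DifferentiableAt ℝ (fderiv ℝ (dirDeriv L G)) A :=
      ((contDiff_dirDeriv hG L).fderiv_right (m := ∞) (by simp)).differentiable (by simp) A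
    have h1 := congrArg (fun f => fderiv ℝ f A H) (funext ih)
    have hTA := (LinearMap.toContinuousLinearMap T).hasFDerivAt (x := A)
    have h2 := (hd.hasFDerivAt.clm_apply hTA).fderiv
    simp only [LinearMap.coe_toContinuousLinearMap'] at h2
    simp only [h2] at h1
    rw [fderiv_fun_neg, fderiv_fun_sum fun k _ => differentiable_dirDeriv hG _ A] at h1
    have hsymm : IsSymmSndFDerivAt ℝ (dirDeriv L G) A :=
      (contDiff_dirDeriv hG L).contDiffAt.isSymmSndFDerivAt (by simpa using ENat.LEInfty.out)
    rw [fderiv_dirDeriv_cons hG, hsymm, List.length_cons, Finset.sum_range_succ']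
    simp only [List.modify_succ_cons, List.modify_zero_cons, dirDeriv]
    simp at h1
    linarith

/-- Bounds on the iterated directional derivatives along vectors of `S` propagate to vectors of
`T`, when a linear form bounded by `c` on `S` is bounded by `K * c` on `T`. -/
theorem abs_dirDeriv_le_of_forall_linear {S T : Set E} {K C : ℝ}
    (hST : ∀ (g : E →ₗ[ℝ] ℝ) (c : ℝ), (∀ b ∈ S, |g b| ≤ c) → ∀ h ∈ T, |g h| ≤ K * c)
    {F : E → ℝ} (hF : ContDiff ℝ ∞ F) {k : ℕ} {x : E}
    (hS : ∀ L : List E, L.length = k → (∀ h ∈ L, h ∈ S) → |dirDeriv L F x| ≤ C)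
    (L : List E) (hLk : L.length = k) (hL : ∀ h ∈ L, h ∈ T) :
    |dirDeriv L F x| ≤ K ^ k * C := by
  have key : ∀ L₁ L₂ : List E, L₁.length + L₂.length = k → (∀ h ∈ L₁, h ∈ T) →
      (∀ h ∈ L₂, h ∈ S) → |dirDeriv (L₁ ++ L₂) F x| ≤ K ^ L₁.length * C := by
    intro L₁
    induction L₁ with
    | nil =>
      intro L₂ h₁ _ h₃
      simpa using hS L₂ (by simpa using h₁) h₃
    | cons h L₁ ih =>
      intro L₂ h₁ h₂ h₃
      have hb : ∀ b ∈ S, |fderiv ℝ (dirDeriv (L₁ ++ L₂) F) x b| ≤ K ^ L₁.length * C := by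
        intro b hb
        have := ih (b :: L₂) (by simp at h₁ ⊢; omega) (fun a ha => h₂ a (by simp [ha]))
          (by simpa using ⟨hb, h₃⟩)
        rwa [dirDeriv_perm hF List.perm_middle] at this
      have := hST (fderiv ℝ (dirDeriv (L₁ ++ L₂) F) x).toLinearMap _ hb h (h₂ h (by simp))
      rw [List.length_cons, pow_succ', mul_assoc]
      exact this
  simpa [hLk] using key L [] (by simpa using hLk) hL (by simp)

/-- A list of vectors of `A ∪ B` can be reordered so that those of `A` come first. -/
theorem List.exists_perm_append_of_forall_mem_union {α : Type*} {A B : Set α} (L : List α)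
    (hL : ∀ h ∈ L, h ∈ A ∪ B) :
    ∃ L₁ L₂ : List α, L.Perm (L₁ ++ L₂) ∧ (∀ h ∈ L₁, h ∈ A) ∧ ∀ h ∈ L₂, h ∈ B := by
  induction L with
  | nil => exact ⟨[], [], by simp⟩
  | cons a L ih =>
    obtain ⟨L₁, L₂, h, h₁, h₂⟩ := ih fun b hb => hL b (by simp [hb])
    rcases hL a (by simp) with ha | ha
    · exact ⟨a :: L₁, L₂, h.cons a, by simpa using ⟨ha, h₁⟩, h₂⟩
    · exact ⟨L₁, a :: L₂, (h.cons a).trans List.perm_middle.symm, h₁, by simpa using ⟨ha, h₂⟩⟩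

/-- Bounds on the directional derivatives along unit vectors give an operator norm bound. -/
theorem norm_iteratedFDeriv_le_of_dirDeriv {F : E → ℝ} (hF : ContDiff ℝ ∞ F) {k : ℕ} {x : E}
    {C : ℝ} (hC : 0 ≤ C)
    (h : ∀ L : List E, L.length = k → (∀ v ∈ L, ‖v‖ ≤ 1) → |dirDeriv L F x| ≤ C) :
    ‖iteratedFDeriv ℝ k F x‖ ≤ C := by
  refine ContinuousMultilinearMap.opNorm_le_bound hC fun m => ?_
  have hm : m = fun i => ‖m i‖ • (‖m i‖⁻¹ • m i) := by
    funext i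
    rcases eq_or_ne (m i) 0 with h0 | h0
    · simp [h0]
    · rw [smul_smul, mul_inv_cancel₀ (norm_ne_zero_iff.2 h0), one_smul]
  have hu := h (List.ofFn fun i => ‖m i‖⁻¹ • m i) (by simp) (by
    intro v hv
    obtain ⟨i, rfl⟩ := (List.mem_ofFn' _ _).1 hv
    rw [norm_smul, norm_inv, norm_norm]
    exact inv_mul_le_one)
  rw [dirDeriv_eq_iteratedFDeriv (n := k) (hF.of_le (by exact_mod_cast le_top)) _ (by simp)] at hu
  have hu' : |iteratedFDeriv ℝ k F x fun i => ‖m i‖⁻¹ • m i| ≤ C := by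
    convert hu using 2
    have : ∀ (l : ℕ) (e : l = k) (f : Fin l → E) (g : Fin k → E),
        (∀ i, f i = g (Fin.cast e i)) → iteratedFDeriv ℝ k F x g = iteratedFDeriv ℝ l F x f := by
      rintro l rfl f g hfg
      rw [show f = g from funext hfg]
    exact this _ (by simp) _ _ fun i => by simp; rfl
  conv_lhs => rw [hm]
  rw [ContinuousMultilinearMap.map_smul_univ, norm_smul, norm_prod, Real.norm_eq_abs, mul_comm]
  simp only [norm_norm]
  gcongr

end DirDeriv

section Division

variable {V : Type*} [NormedAddCommGroup V] [NormedSpace ℝ V]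

/-- A maximum principle for the operator `φ ↦ ℓ ∂ᵥ φ + b φ` on a ball. -/
theorem le_of_mul_fderiv_add_le [ProperSpace V] {ℓ : V →L[ℝ] ℝ} {v : V}
    (hproj : ∀ x, ‖x - ℓ x • v‖ ≤ ‖x‖) {φ : V → ℝ} (hφ : Differentiable ℝ φ) {b R M : ℝ}
    (hb : 1 ≤ b) (hM : 0 ≤ M)
    (h : ∀ x ∈ Metric.closedBall (0 : V) R, ℓ x * fderiv ℝ φ x v + b * φ x ≤ M) {x : V}
    (hx : x ∈ Metric.closedBall (0 : V) R) : φ x ≤ M := by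
  obtain ⟨y, hy, hmax⟩ := (isCompact_closedBall (0 : V) R).exists_isMaxOn ⟨x, hx⟩
    hφ.continuous.continuousOn
  refine (hmax hx).trans ?_
  have hmem : y - ℓ y • v ∈ Metric.closedBall (0 : V) R := by
    rw [mem_closedBall_zero_iff] at hy ⊢
    exact (hproj y).trans hy
  have hcone := sub_mem_posTangentConeAt_of_segment_subset
    ((convex_closedBall (0 : V) R).segment_subset hy hmem)
  have hle := hmax.localize.hasFDerivWithinAt_nonpos (hφ y).hasFDerivAt.hasFDerivWithinAt hcone
  have := h y hy
  simp only [sub_sub_cancel_left, map_neg, map_smul, smul_eq_mul] at hle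
  change φ y ≤ M
  by_contra! hlt
  nlinarith

theorem dirDeriv_replicate_succ_mul {ℓ : V →L[ℝ] ℝ} {v : V} (hv : ℓ v = 1) {G : V → ℝ}
    (hG : ContDiff ℝ ∞ G) (a : ℕ) :
    dirDeriv (List.replicate (a + 1) v) (fun x => ℓ x * G x) = fun x =>
      ℓ x * dirDeriv (List.replicate (a + 1) v) G x
        + (a + 1) * dirDeriv (List.replicate a v) G x := by
  have step : ∀ (c : ℝ) (H K : V → ℝ) (x : V), Differentiable ℝ H → Differentiable ℝ K →
      fderiv ℝ (fun x => ℓ x * H x + c * K x) x v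
        = ℓ x * fderiv ℝ H x v + H x + c * fderiv ℝ K x v := by
    intro c H K x hH hK
    have := ((ℓ.hasFDerivAt (x := x)).mul (hH x).hasFDerivAt).add
      ((hK x).hasFDerivAt.const_mul c)
    have h2 := this.fderiv
    change fderiv ℝ (fun x => ℓ x * H x + c * K x) x = _ at h2
    rw [h2]
    simp [hv]
  induction a with
  | zero =>
    funext x
    have := step 0 G G x (hG.differentiable (by simp)) (hG.differentiable (by simp))
    simp only [zero_mul, add_zero] at this
    simp [dirDeriv, this]
  | succ a ih =>
    funext x
    rw [List.replicate_succ]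
    simp only [dirDeriv]
    rw [ih, step _ _ _ _ (differentiable_dirDeriv hG _) (differentiable_dirDeriv hG _)]
    simp only [List.replicate_succ, dirDeriv]
    push_cast
    ring

theorem dirDeriv_mul_of_forall_mem_ker {ℓ : V →L[ℝ] ℝ} {G : V → ℝ} (hG : ContDiff ℝ ∞ G)
    (L : List V) (hL : ∀ h ∈ L, ℓ h = 0) :
    dirDeriv L (fun x => ℓ x * G x) = fun x => ℓ x * dirDeriv L G x := by
  induction L with
  | nil => rfl
  | cons h L ih =>
    funext x
    simp only [dirDeriv]
    rw [ih fun a ha => hL a (by simp [ha]),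
      fderiv_fun_mul ℓ.differentiableAt (differentiable_dirDeriv hG L x)]
    simp [hL h (by simp)]

/-- Quantitative division by a linear form: the derivatives of order `q` of `g` are controlled by
the derivatives of order `q + 1` of `ℓ * g`. -/
theorem abs_dirDeriv_le_of_dirDeriv_mul [ProperSpace V] {ℓ : V →L[ℝ] ℝ} {v : V}
    (hv : ℓ v = 1) (hv1 : ‖v‖ ≤ 1) (hproj : ∀ x, ‖x - ℓ x • v‖ ≤ ‖x‖)
    (hℓ : ∀ x, |ℓ x| ≤ 2 * ‖x‖) {g : V → ℝ} (hg : ContDiff ℝ ∞ g) {q : ℕ} {R M : ℝ}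
    (hM : 0 ≤ M)
    (h : ∀ x ∈ Metric.closedBall (0 : V) R, ∀ L : List V, L.length = q + 1 →
      (∀ u ∈ L, ‖u‖ ≤ 1) → |dirDeriv L (fun x => ℓ x * g x) x| ≤ M)
    {x : V} (hx : x ∈ Metric.closedBall (0 : V) R) (L : List V) (hLq : L.length = q)
    (hL : ∀ u ∈ L, ‖u‖ ≤ 1) : |dirDeriv L g x| ≤ 3 ^ q * M := by
  refine abs_dirDeriv_le_of_forall_linear (S := {v} ∪ {u | ‖u‖ ≤ 1 ∧ ℓ u = 0})
    (T := {u | ‖u‖ ≤ 1}) ?_ hg ?_ L hLq hL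
  · intro f c hc u hu
    have h1 : |f v| ≤ c := hc v (by simp)
    have h2 : |f (u - ℓ u • v)| ≤ c :=
      hc _ (Or.inr ⟨(hproj u).trans hu, by simp [hv]⟩)
    have h3 : |ℓ u| ≤ 2 := (hℓ u).trans (by have : ‖u‖ ≤ 1 := hu; linarith)
    have h4 : f u = f (u - ℓ u • v) + ℓ u * f v := by simp
    have h5 : |ℓ u * f v| ≤ 2 * c := by
      rw [abs_mul]
      exact mul_le_mul h3 h1 (abs_nonneg _) (by norm_num)
    rw [h4]
    exact (abs_add_le _ _).trans (by linarith)
  · intro L hLq hL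
    obtain ⟨L₁, L₂, hperm, h₁, h₂⟩ := L.exists_perm_append_of_forall_mem_union hL
    obtain ⟨a, rfl⟩ : ∃ a, L₁ = List.replicate a v := ⟨_, List.eq_replicate_of_mem h₁⟩
    rw [dirDeriv_perm hg hperm, dirDeriv_append]
    have hG := contDiff_dirDeriv hg L₂
    have hlen : a + L₂.length = q := by
      rw [← hLq, hperm.length_eq]; simp
    have hbound : ∀ y ∈ Metric.closedBall (0 : V) R,
        |ℓ y * fderiv ℝ (dirDeriv (List.replicate a v) (dirDeriv L₂ g)) y v
          + (a + 1) * dirDeriv (List.replicate a v) (dirDeriv L₂ g) y| ≤ M := by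
      intro y hy
      have := h y hy (List.replicate (a + 1) v ++ L₂) (by simp; omega) (by
        intro u hu
        rcases List.mem_append.1 hu with hu | hu
        · rw [List.eq_of_mem_replicate hu]; exact hv1
        · exact (h₂ u hu).1)
      rw [dirDeriv_append, dirDeriv_mul_of_forall_mem_ker hg L₂ fun u hu => (h₂ u hu).2,
        dirDeriv_replicate_succ_mul hv hG] at this
      simpa [List.replicate_succ, dirDeriv] using this
    have hdiff := differentiable_dirDeriv hG (List.replicate a v)
    have ha : (1 : ℝ) ≤ a + 1 := by simp
    rw [abs_le]
    constructor
    · have := le_of_mul_fderiv_add_le hproj (φ := fun y =>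
        -dirDeriv (List.replicate a v) (dirDeriv L₂ g) y) hdiff.neg ha hM (fun y hy => by
          have := (abs_le.1 (hbound y hy)).1
          rw [fderiv_fun_neg, _root_.neg_apply]
          linarith) hx
      linarith
    · exact le_of_mul_fderiv_add_le hproj hdiff ha hM (fun y hy => (abs_le.1 (hbound y hy)).2) hx

end Division

section MatrixBounds

variable {d : ℕ}

/-- The embedding of vectors as diagonal matrices. -/
def diagonalVec (d : ℕ) : EuclideanSpace ℝ (Fin d) →ₗ[ℝ] Matrix (Fin d) (Fin d) ℝ where
  toFun r := Matrix.diagonal fun i => r i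
  map_add' r s := by simp [Matrix.diagonal_add]
  map_smul' c r := by ext i j; by_cases h : i = j <;> simp [h]

theorem diagonalVec_apply (r : EuclideanSpace ℝ (Fin d)) :
    diagonalVec d r = Matrix.diagonal fun i => r i := rfl

theorem norm_diagonalVec (r : EuclideanSpace ℝ (Fin d)) : ‖diagonalVec d r‖ = ‖r‖ := by
  rw [diagonalVec_apply, Matrix.frobenius_norm_diagonal]

/-- The symmetrization `e_{ij} + e_{ji}` of a matrix unit. -/
def symUnit (i j : Fin d) : Matrix (Fin d) (Fin d) ℝ :=
  Matrix.single i j 1 + Matrix.single j i 1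

/-- The antisymmetrization `e_{ij} - e_{ji}` of a matrix unit. -/
def skewUnit (i j : Fin d) : Matrix (Fin d) (Fin d) ℝ :=
  Matrix.single i j 1 - Matrix.single j i 1

theorem symUnit_self (i : Fin d) :
    symUnit i i = (2 : ℝ) • diagonalVec d (EuclideanSpace.single i 1) := by
  ext a b
  rcases eq_or_ne a b with rfl | h
  · rcases eq_or_ne i a with rfl | h'
    · simp [symUnit, diagonalVec_apply]; norm_num
    · simp [symUnit, diagonalVec_apply, h', h'.symm]
  · have : ¬ (i = a ∧ i = b) := by rintro ⟨rfl, rfl⟩; exact h rfl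
    simp [symUnit, diagonalVec_apply, h, Matrix.single, this]

theorem lie_skewUnit_diagonal (i j : Fin d) (x : EuclideanSpace ℝ (Fin d)) :
    ⁅skewUnit i j, diagonalVec d x⁆ = (x j - x i) • symUnit i j := by
  simp only [Ring.lie_def, skewUnit, symUnit, diagonalVec_apply]
  ext a b
  simp only [Matrix.sub_apply, Matrix.mul_diagonal, Matrix.diagonal_mul, Matrix.add_apply,
    Matrix.smul_apply, Matrix.single, Matrix.of_apply, smul_eq_mul]
  by_cases h1 : i = a ∧ j = b <;> by_cases h2 : j = a ∧ i = b <;> simp only [h1, h2, if_false]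
  · obtain ⟨rfl, rfl⟩ := h1; obtain ⟨rfl, -⟩ := h2; simp
  · obtain ⟨rfl, rfl⟩ := h1; simp [h2]
  · obtain ⟨rfl, rfl⟩ := h2; simp [h1]; ring
  · simp

theorem lie_skewUnit_symUnit (i j k l : Fin d) :
    ⁅skewUnit i j, symUnit k l⁆ =
      (if j = k then symUnit i l else 0) + (if j = l then symUnit i k else 0)
        - (if i = k then symUnit j l else 0) - (if i = l then symUnit j k else 0) := by
  have hs : ∀ a b c e : Fin d, (Matrix.single a b 1 : Matrix (Fin d) (Fin d) ℝ)
      * Matrix.single c e 1 = if b = c then Matrix.single a e 1 else 0 := by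
    intro a b c e
    split_ifs with h
    · subst h; simp
    · simp [h]
  simp only [Ring.lie_def, skewUnit, symUnit, mul_add, sub_mul, add_mul, mul_sub, hs,
    eq_comm (a := k), eq_comm (a := l)]
  split_ifs <;> abel

theorem fderiv_lie_eq_zero {G : Matrix (Fin d) (Fin d) ℝ → ℝ} (hG : Differentiable ℝ G)
    (htr : ∀ A B, G (A * B) = G (B * A)) (X A : Matrix (Fin d) (Fin d) ℝ) :
    fderiv ℝ G A ⁅X, A⁆ = 0 := by
  have := fderiv_eq_fderiv_of_forall_smul (Y := X * A) (Z := A * X) (hG A) fun t => by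
    simpa [add_mul, mul_add] using htr (1 + t • X) A
  rw [Ring.lie_def, map_sub]
  exact sub_eq_zero.2 this

/-- The commutator with `X` as a linear map. -/
def lieLinearMap (X : Matrix (Fin d) (Fin d) ℝ) :
    Matrix (Fin d) (Fin d) ℝ →ₗ[ℝ] Matrix (Fin d) (Fin d) ℝ :=
  LinearMap.mulLeft ℝ X - LinearMap.mulRight ℝ X

theorem lieLinearMap_apply (X A : Matrix (Fin d) (Fin d) ℝ) : lieLinearMap X A = ⁅X, A⁆ := rfl

theorem sub_mul_dirDeriv_symUnit {G : Matrix (Fin d) (Fin d) ℝ → ℝ} (hG : ContDiff ℝ ∞ G)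
    (htr : ∀ A B, G (A * B) = G (B * A)) (i j : Fin d) (L : List (Matrix (Fin d) (Fin d) ℝ))
    (x : EuclideanSpace ℝ (Fin d)) :
    (x i - x j) * dirDeriv (symUnit i j :: L) G (diagonalVec d x) =
      ∑ k ∈ Finset.range L.length,
        dirDeriv (L.modify k (lieLinearMap (skewUnit i j))) G (diagonalVec d x) := by
  have := fderiv_dirDeriv_linearMap_apply_self hG (lieLinearMap (skewUnit i j))
    (fun A => fderiv_lie_eq_zero (hG.differentiable (by simp)) htr _ A) L (diagonalVec d x)
  rw [lieLinearMap_apply, lie_skewUnit_diagonal, map_smul, smul_eq_mul] at this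
  simp only [dirDeriv]
  linarith

theorem exists_projection_sub_coord {i j : Fin d} (hij : i ≠ j) :
    ∃ (ℓ : EuclideanSpace ℝ (Fin d) →L[ℝ] ℝ) (v : EuclideanSpace ℝ (Fin d)),
      (∀ x, ℓ x = x i - x j) ∧ ℓ v = 1 ∧ ‖v‖ ≤ 1 ∧ (∀ x, ‖x - ℓ x • v‖ ≤ ‖x‖) ∧
        ∀ x, |ℓ x| ≤ 2 * ‖x‖ := by
  set v : EuclideanSpace ℝ (Fin d) :=
    (2⁻¹ : ℝ) • (EuclideanSpace.single i 1 - EuclideanSpace.single j 1) with hv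
  have hinner : ∀ x : EuclideanSpace ℝ (Fin d), inner ℝ x v = (x i - x j) / 2 := by
    intro x
    simp [hv, inner_smul_right, inner_sub_right, EuclideanSpace.inner_single_right]
    ring
  have hvv : v i - v j = 1 := by
    simp [hv, hij, hij.symm]
    norm_num
  have hnv : ‖v‖ ^ 2 = 1 / 2 := by rw [← real_inner_self_eq_norm_sq, hinner, hvv]
  have hx : ∀ x, (EuclideanSpace.proj i - EuclideanSpace.proj j : EuclideanSpace ℝ (Fin d) →L[ℝ] ℝ) x
      = x i - x j := fun x => by simp
  refine ⟨EuclideanSpace.proj i - EuclideanSpace.proj j, v, hx, by simpa using hvv,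
    by nlinarith [norm_nonneg v], fun x => ?_, fun x => ?_⟩
  · rw [hx]
    refine (pow_le_pow_iff_left₀ (norm_nonneg _) (norm_nonneg _) two_ne_zero).1 ?_
    rw [norm_sub_sq_real, inner_smul_right, hinner, norm_smul, mul_pow, hnv, Real.norm_eq_abs,
      sq_abs]
    nlinarith [sq_nonneg (x i - x j)]
  · have h1 := PiLp.norm_apply_le x i
    have h2 := PiLp.norm_apply_le x j
    have := norm_sub_le (x i) (x j)
    rw [hx]
    simp only [Real.norm_eq_abs] at *
    linarith

theorem abs_apply_lie_skewUnit_symUnit_le {f : Matrix (Fin d) (Fin d) ℝ →ₗ[ℝ] ℝ} {c : ℝ}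
    (hc : 0 ≤ c) (hoff : ∀ a b, a ≠ b → |f (symUnit a b)| ≤ c)
    (hdiag : ∀ r, ‖r‖ ≤ 1 → |f (diagonalVec d r)| ≤ c) (i j k l : Fin d) :
    |f ⁅skewUnit i j, symUnit k l⁆| ≤ 8 * c := by
  have hE : ∀ a b, |f (symUnit a b)| ≤ 2 * c := by
    intro a b
    rcases eq_or_ne a b with rfl | h
    · rw [symUnit_self, map_smul, smul_eq_mul, abs_mul, abs_two]
      exact mul_le_mul_of_nonneg_left (hdiag _ (by simp)) (by norm_num)
    · linarith [hoff a b h]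
  have hE' : ∀ (p : Prop) [Decidable p] (a b : Fin d),
      |f (if p then symUnit a b else 0)| ≤ 2 * c := by
    intro p _ a b
    split_ifs
    · exact hE a b
    · simpa using hc
  rw [lie_skewUnit_symUnit, map_sub, map_sub, map_add]
  refine (abs_sub _ _).trans ?_
  have h1 := hE' (j = k) i l
  have h2 := hE' (j = l) i k
  have h3 := hE' (i = k) j l
  have h4 := hE' (i = l) j k
  have h5 := abs_add_le (f (if j = k then symUnit i l else 0)) (f (if j = l then symUnit i k else 0))
  have h6 := abs_sub (f (if j = k then symUnit i l else 0) + f (if j = l then symUnit i k else 0))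
    (f (if i = k then symUnit j l else 0))
  linarith

/-- The derivatives of a conjugation-invariant function at diagonal matrices along diagonal
directions and off-diagonal units are controlled by those along diagonal directions only. -/
theorem exists_abs_dirDeriv_append_le (d k p : ℕ) :
    ∃ C : ℝ, 0 ≤ C ∧ ∀ G : Matrix (Fin d) (Fin d) ℝ → ℝ, ContDiff ℝ ∞ G →
      (∀ A B, G (A * B) = G (B * A)) → ∀ R M : ℝ, 0 ≤ M →
      (∀ x ∈ Metric.closedBall (0 : EuclideanSpace ℝ (Fin d)) R,
        ∀ L : List (EuclideanSpace ℝ (Fin d)), L.length = k → (∀ u ∈ L, ‖u‖ ≤ 1) →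
          |dirDeriv (L.map (diagonalVec d)) G (diagonalVec d x)| ≤ M) →
      ∀ x ∈ Metric.closedBall (0 : EuclideanSpace ℝ (Fin d)) R,
        ∀ (L₁ : List (EuclideanSpace ℝ (Fin d))) (L₂ : List (Matrix (Fin d) (Fin d) ℝ)),
          L₁.length + L₂.length = k → L₂.length ≤ p → (∀ u ∈ L₁, ‖u‖ ≤ 1) →
          (∀ H ∈ L₂, ∃ i j, i ≠ j ∧ H = symUnit i j) →
          |dirDeriv (L₁.map (diagonalVec d) ++ L₂) G (diagonalVec d x)| ≤ C * M := by
  induction p with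
  | zero =>
    refine ⟨1, zero_le_one, fun G _ _ R M _ h x hx L₁ L₂ hlen h0 h₁ _ => ?_⟩
    obtain rfl : L₂ = [] := List.length_eq_zero_iff.1 (by omega)
    simpa using h x hx L₁ (by simpa using hlen) h₁
  | succ p ih =>
    obtain ⟨C, hC, ih⟩ := ih
    refine ⟨C + 3 ^ k * (p * (8 * C)), by positivity,
      fun G hG htr R M hM h x hx L₁ L₂ hlen hp h₁ h₂ => ?_⟩
    replace ih := ih G hG htr R M hM h
    rcases Nat.lt_or_ge p L₂.length with hlt | hle
    swap
    · refine (ih x hx L₁ L₂ hlen hle h₁ h₂).trans ?_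
      gcongr
      exact le_add_of_nonneg_right (by positivity)
    obtain _ | ⟨H, L⟩ := L₂
    · simp at hlt
    obtain ⟨⟨i, j, hij, rfl⟩, hL⟩ := List.forall_mem_cons.1 h₂
    have hLp : L.length = p := by simp at hp hlt; omega
    have hL₁ : L₁.length + p + 1 = k := by simp at hlen; omega
    have hterm : ∀ y ∈ Metric.closedBall (0 : EuclideanSpace ℝ (Fin d)) R,
        ∀ L' : List (EuclideanSpace ℝ (Fin d)), L'.length = L₁.length + 1 →
        (∀ u ∈ L', ‖u‖ ≤ 1) → ∀ m < L.length,
        |dirDeriv (L'.map (diagonalVec d) ++ L.modify m (lieLinearMap (skewUnit i j))) G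
          (diagonalVec d y)| ≤ 8 * (C * M) := by
      intro y hy L' hL' hu m hm
      have hperm : (L'.map (diagonalVec d) ++ L.modify m (lieLinearMap (skewUnit i j))).Perm
          (lieLinearMap (skewUnit i j) L[m] :: (L'.map (diagonalVec d) ++ L.eraseIdx m)) := by
        rw [List.modify_eq_set_get _ hm]
        exact ((List.set_perm_cons_eraseIdx hm _).append_left _).trans List.perm_middle
      have herase : ∀ H ∈ L.eraseIdx m, ∃ i j, i ≠ j ∧ H = symUnit i j :=
        fun H hH => hL H (List.mem_of_mem_eraseIdx hH)
      have hlen' := List.length_eraseIdx_add_one hm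
      rw [dirDeriv_perm hG hperm]
      obtain ⟨a, b, hab, he⟩ := hL L[m] (List.getElem_mem hm)
      rw [he, lieLinearMap_apply]
      refine abs_apply_lie_skewUnit_symUnit_le (f := (fderiv ℝ (dirDeriv
        (L'.map (diagonalVec d) ++ L.eraseIdx m) G) (diagonalVec d y)).toLinearMap)
        (by positivity) ?_ ?_ i j a b
      · intro a b hab
        have := ih y hy L' (symUnit a b :: L.eraseIdx m) (by simp; omega) (by simp; omega) hu
          (List.forall_mem_cons.2 ⟨⟨a, b, hab, rfl⟩, herase⟩)
        rwa [dirDeriv_perm hG List.perm_middle] at this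
      · intro r hr
        exact ih y hy (r :: L') (L.eraseIdx m) (by simp; omega) (by omega)
          (List.forall_mem_cons.2 ⟨hr, hu⟩) herase
    have hdd : ∀ (L' : List (EuclideanSpace ℝ (Fin d))) (L'' : List (Matrix (Fin d) (Fin d) ℝ))
        (y : EuclideanSpace ℝ (Fin d)),
        dirDeriv L' (fun y => dirDeriv L'' G (diagonalVec d y)) y =
          dirDeriv (L'.map (diagonalVec d) ++ L'') G (diagonalVec d y) := by
      intro L' L'' y
      rw [dirDeriv_comp_linearMap (contDiff_dirDeriv hG L''), dirDeriv_append]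
    have hcd : ∀ L'' : List (Matrix (Fin d) (Fin d) ℝ),
        ContDiff ℝ ∞ fun y => dirDeriv L'' G (diagonalVec d y) := fun L'' =>
      contDiff_comp_linearMap (contDiff_dirDeriv hG L'') _
    rw [← hdd]
    obtain ⟨ℓ, v, hℓ, hv, hv1, hproj, hℓn⟩ := exists_projection_sub_coord hij
    have hmain := abs_dirDeriv_le_of_dirDeriv_mul (M := p * (8 * (C * M))) hv hv1 hproj hℓn
      (hcd (symUnit i j :: L)) (q := L₁.length) (R := R) (by positivity) ?_ hx L₁ rfl h₁
    · refine hmain.trans ?_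
      have : (3 : ℝ) ^ L₁.length ≤ 3 ^ k := pow_le_pow_right₀ (by norm_num) (by omega)
      calc (3 : ℝ) ^ L₁.length * (p * (8 * (C * M))) ≤ 3 ^ k * (p * (8 * (C * M))) := by gcongr
        _ ≤ _ := by nlinarith [mul_nonneg hC hM]
    · intro y hy L' hL' hu
      simp only [hℓ, sub_mul_dirDeriv_symUnit hG htr]
      rw [dirDeriv_sum fun m => hcd _]
      refine (Finset.abs_sum_le_sum_abs _ _).trans ?_
      rw [← hLp, ← nsmul_eq_mul]
      conv_rhs => rw [← Finset.card_range L.length]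
      refine Finset.sum_le_card_nsmul _ _ _ fun m hm => ?_
      rw [hdd]
      exact hterm y hy L' hL' hu m (Finset.mem_range.1 hm)

end MatrixBounds

section SymmetricMatrices

variable {d : ℕ}

theorem frobenius_norm_sq_eq_trace (A : Matrix (Fin d) (Fin d) ℝ) :
    ‖A‖ ^ 2 = (A * Aᵀ).trace := by
  have : 0 ≤ ∑ i, ∑ j, ‖A i j‖ ^ (2 : ℝ) := by positivity
  rw [Matrix.frobenius_norm_def, ← Real.sqrt_eq_rpow, Real.sq_sqrt this]
  simp [Matrix.trace, Matrix.mul_apply, sq]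

theorem frobenius_norm_conj {g : Matrix (Fin d) (Fin d) ℝ} (hg : gᵀ * g = 1)
    (A : Matrix (Fin d) (Fin d) ℝ) : ‖g * A * gᵀ‖ = ‖A‖ := by
  rw [← pow_left_inj₀ (norm_nonneg _) (norm_nonneg _) two_ne_zero, frobenius_norm_sq_eq_trace,
    frobenius_norm_sq_eq_trace]
  have : g * A * gᵀ * (g * A * gᵀ)ᵀ = g * (A * Aᵀ * gᵀ) := by
    simp only [Matrix.transpose_mul, Matrix.transpose_transpose, Matrix.mul_assoc]
    rw [← Matrix.mul_assoc gᵀ g, hg, Matrix.one_mul]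
  rw [this, Matrix.trace_mul_comm, Matrix.mul_assoc, hg, Matrix.mul_one]

theorem abs_apply_le_frobenius_norm (A : Matrix (Fin d) (Fin d) ℝ) (i j : Fin d) :
    |A i j| ≤ ‖A‖ := by
  rw [← pow_le_pow_iff_left₀ (abs_nonneg _) (norm_nonneg _) two_ne_zero,
    frobenius_norm_sq_eq_trace, sq_abs]
  simp only [Matrix.trace, Matrix.diag, Matrix.mul_apply, Matrix.transpose_apply, ← sq]
  exact (Finset.single_le_sum (f := fun j => A i j ^ 2) (fun j _ => sq_nonneg _)
    (Finset.mem_univ j)).trans (Finset.single_le_sum (f := fun i => ∑ j, A i j ^ 2)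
      (fun i _ => Finset.sum_nonneg fun j _ => sq_nonneg _) (Finset.mem_univ i))

theorem norm_toLp_diag_le (A : Matrix (Fin d) (Fin d) ℝ) :
    ‖WithLp.toLp 2 fun i => A i i‖ ≤ ‖A‖ := by
  rw [← pow_le_pow_iff_left₀ (norm_nonneg _) (norm_nonneg _) two_ne_zero,
    frobenius_norm_sq_eq_trace, EuclideanSpace.norm_sq_eq]
  simp only [Matrix.trace, Matrix.diag, Matrix.mul_apply, Matrix.transpose_apply, ← sq,
    Real.norm_eq_abs, sq_abs]
  exact Finset.sum_le_sum fun i _ => Finset.single_le_sum (f := fun j => A i j ^ 2)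
    (fun j _ => sq_nonneg _) (Finset.mem_univ i)

/-- The spectral theorem for real symmetric matrices. -/
theorem exists_eq_conj_diagonalVec {A : Matrix (Fin d) (Fin d) ℝ} (hA : A.IsSymm) :
    ∃ (g : Matrix (Fin d) (Fin d) ℝ) (r : EuclideanSpace ℝ (Fin d)),
      g * gᵀ = 1 ∧ gᵀ * g = 1 ∧ A = g * diagonalVec d r * gᵀ := by
  have hH : A.IsHermitian := by
    rw [Matrix.IsHermitian, Matrix.conjTranspose_eq_transpose_of_trivial]
    exact hA
  have hs : ∀ B : Matrix (Fin d) (Fin d) ℝ, star B = Bᵀ := fun B => by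
    rw [Matrix.star_eq_conjTranspose, Matrix.conjTranspose_eq_transpose_of_trivial]
  refine ⟨hH.eigenvectorUnitary, WithLp.toLp 2 hH.eigenvalues, ?_, ?_, ?_⟩
  · rw [← hs]; exact Unitary.mul_star_self_of_mem hH.eigenvectorUnitary.2
  · rw [← hs]; exact Unitary.star_mul_self_of_mem hH.eigenvectorUnitary.2
  · conv_lhs => rw [hH.spectral_theorem]
    rw [Unitary.conjStarAlgAut_apply, hs]
    rfl

theorem eq_diagonalVec_add_sum_symUnit {A : Matrix (Fin d) (Fin d) ℝ} (hA : A.IsSymm) :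
    A = diagonalVec d (WithLp.toLp 2 fun i => A i i) +
      ∑ i, ∑ j, if i ≠ j then (A i j / 2) • symUnit i j else 0 := by
  ext a b
  have hab := hA.apply a b
  simp only [diagonalVec_apply, Matrix.add_apply, Matrix.sum_apply, Matrix.diagonal_apply]
  have h1 : ∀ i j : Fin d, (if i ≠ j then (A i j / 2) • symUnit i j else 0 : Matrix _ _ ℝ) a b
      = (if i = a then if j = b then (if i ≠ j then A i j / 2 else 0) else 0 else 0)
        + (if j = a then if i = b then (if i ≠ j then A i j / 2 else 0) else 0 else 0) := by
    intro i j
    rcases eq_or_ne i j with rfl | h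
    · simp
    · rw [if_pos h]
      simp only [symUnit, Matrix.smul_apply, Matrix.add_apply, Matrix.single_apply, smul_eq_mul,
        if_pos h, mul_add, mul_ite, mul_one, mul_zero, ite_and]
  simp only [h1, Finset.sum_add_distrib]
  rw [Finset.sum_comm (f := fun i j => if j = a then if i = b then (if i ≠ j then A i j / 2 else 0)
    else 0 else 0)]
  simp only [Finset.sum_ite_irrel, Finset.sum_ite_eq', Finset.mem_univ, if_true,
    Finset.sum_const_zero]
  rcases eq_or_ne a b with rfl | h
  · simp
  · simp [h, h.symm, hab]

theorem abs_apply_le_of_isSymm {f : Matrix (Fin d) (Fin d) ℝ →ₗ[ℝ] ℝ} {c : ℝ} (hc : 0 ≤ c)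
    (hoff : ∀ a b, a ≠ b → |f (symUnit a b)| ≤ c)
    (hdiag : ∀ r, ‖r‖ ≤ 1 → |f (diagonalVec d r)| ≤ c) {A : Matrix (Fin d) (Fin d) ℝ}
    (hA : A.IsSymm) (hA1 : ‖A‖ ≤ 1) : |f A| ≤ (1 + d * d) * c := by
  rw [eq_diagonalVec_add_sum_symUnit hA, map_add, map_sum]
  have h1 := hdiag _ ((norm_toLp_diag_le A).trans hA1)
  have h2 : |∑ i, f (∑ j, if i ≠ j then (A i j / 2) • symUnit i j else 0)| ≤ d * d * c := by
    refine (Finset.abs_sum_le_sum_abs _ _).trans ?_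
    refine (Finset.sum_le_card_nsmul _ _ (d * c) fun i _ => ?_).trans_eq (by simp; ring)
    rw [map_sum]
    refine (Finset.abs_sum_le_sum_abs _ _).trans ?_
    refine (Finset.sum_le_card_nsmul _ _ c fun j _ => ?_).trans_eq (by simp)
    split_ifs with h
    · rw [map_smul, smul_eq_mul, abs_mul]
      have h3 : |A i j / 2| ≤ 1 := by
        rw [abs_div, abs_two]
        linarith [(abs_apply_le_frobenius_norm A i j).trans hA1]
      exact (mul_le_mul h3 (hoff i j h) (abs_nonneg _) zero_le_one).trans_eq (one_mul c)
    · simpa using hc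
  exact (abs_add_le _ _).trans (by linarith)

/-- The derivatives of a smooth conjugation-invariant function on symmetric matrices are controlled
by the derivatives of its restriction to diagonal matrices. -/
theorem exists_abs_dirDeriv_isSymm_le (d k : ℕ) :
    ∃ C : ℝ, 0 ≤ C ∧ ∀ G : Matrix (Fin d) (Fin d) ℝ → ℝ, ContDiff ℝ ∞ G →
      (∀ A B, G (A * B) = G (B * A)) → ∀ R M : ℝ, 0 ≤ M →
      (∀ x ∈ Metric.closedBall (0 : EuclideanSpace ℝ (Fin d)) R,
        ∀ L : List (EuclideanSpace ℝ (Fin d)), L.length = k → (∀ u ∈ L, ‖u‖ ≤ 1) →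
          |dirDeriv L (fun x => G (diagonalVec d x)) x| ≤ M) →
      ∀ A : Matrix (Fin d) (Fin d) ℝ, A.IsSymm → ‖A‖ ≤ R →
        ∀ L : List (Matrix (Fin d) (Fin d) ℝ), L.length = k →
          (∀ H ∈ L, H.IsSymm ∧ ‖H‖ ≤ 1) → |dirDeriv L G A| ≤ C * M := by
  obtain ⟨C, hC, hmix⟩ := exists_abs_dirDeriv_append_le d k k
  refine ⟨(1 + d * d) ^ k * C, by positivity, fun G hG htr R M hM h A hA hAR L hLk hL => ?_⟩
  replace hmix := hmix G hG htr R M hM fun x hx L hL hu => by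
    simpa only [dirDeriv_comp_linearMap hG] using h x hx L hL hu
  obtain ⟨g, r, hg, hg', hgr⟩ := exists_eq_conj_diagonalVec hA
  let T : Matrix (Fin d) (Fin d) ℝ →ₗ[ℝ] Matrix (Fin d) (Fin d) ℝ :=
    LinearMap.mulRight ℝ g ∘ₗ LinearMap.mulLeft ℝ gᵀ
  have hT : ∀ B, T B = gᵀ * B * g := fun B => rfl
  have hGT : (fun B => G (T B)) = G := by
    funext B
    rw [hT, htr, ← Matrix.mul_assoc, hg, Matrix.one_mul]
  have hTA : T A = diagonalVec d r := by
    rw [hT, hgr]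
    simp only [Matrix.mul_assoc, hg', Matrix.mul_one]
    rw [← Matrix.mul_assoc, hg', Matrix.one_mul]
  have hTn : ∀ B, ‖T B‖ = ‖B‖ := fun B => by
    have := frobenius_norm_conj (g := gᵀ) (by simpa using hg) B
    simpa [hT] using this
  rw [← hGT, dirDeriv_comp_linearMap hG T]
  simp only
  rw [hTA, mul_assoc]
  refine abs_dirDeriv_le_of_forall_linear
    (S := {H | ∃ u, ‖u‖ ≤ 1 ∧ H = diagonalVec d u} ∪ {H | ∃ i j, i ≠ j ∧ H = symUnit i j})
    (T := {H | H.IsSymm ∧ ‖H‖ ≤ 1}) ?_ hG ?_ (L.map T) (by simpa using hLk) ?_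
  · intro f c hc H hH
    have hc0 : 0 ≤ c := (abs_nonneg _).trans (hc (diagonalVec d 0) (Or.inl ⟨0, by simp, rfl⟩))
    exact abs_apply_le_of_isSymm hc0 (fun a b hab => hc _ (Or.inr ⟨a, b, hab, rfl⟩))
      (fun u hu => hc _ (Or.inl ⟨u, hu, rfl⟩)) hH.1 hH.2
  · intro L hLk hL
    obtain ⟨L₁, L₂, hperm, h₁, h₂⟩ := L.exists_perm_append_of_forall_mem_union hL
    obtain ⟨L₁', rfl, hu₁⟩ : ∃ L' : List (EuclideanSpace ℝ (Fin d)),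
        L₁ = L'.map (diagonalVec d) ∧ ∀ u ∈ L', ‖u‖ ≤ 1 := by
      clear hperm
      induction L₁ with
      | nil => exact ⟨[], by simp⟩
      | cons H L₁ ih =>
        obtain ⟨L', rfl, h'⟩ := ih fun H hH => h₁ H (by simp [hH])
        obtain ⟨u, hu, rfl⟩ := h₁ H (by simp)
        exact ⟨u :: L', by simp, by simpa using ⟨hu, h'⟩⟩
    have hlen : L₁'.length + L₂.length = k := by
      rw [← hLk, hperm.length_eq]; simp
    rw [dirDeriv_perm hG hperm]
    refine hmix r ?_ L₁' L₂ hlen (by omega) hu₁ h₂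
    rw [mem_closedBall_zero_iff, ← norm_diagonalVec, ← hTA, hTn]
    exact hAR
  · intro H hH
    obtain ⟨B, hB, rfl⟩ := List.mem_map.1 hH
    refine ⟨?_, (hTn B).trans_le (hL B hB).2⟩
    rw [hT, Matrix.IsSymm]
    simp only [Matrix.transpose_mul, Matrix.transpose_transpose, (hL B hB).1.eq, Matrix.mul_assoc]

end SymmetricMatrices

section SymmetricPolynomials

theorem contDiff_eval_mvPolynomial {σ E : Type*} [NormedAddCommGroup E] [NormedSpace ℝ E]
    {n : ℕ∞ω} {f : E → σ → ℝ} (hf : ∀ i, ContDiff ℝ n fun x => f x i) (P : MvPolynomial σ ℝ) :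
    ContDiff ℝ n fun x => MvPolynomial.eval (f x) P := by
  induction P using MvPolynomial.induction_on with
  | C a => simpa using contDiff_const
  | add P Q hP hQ => simpa using hP.add hQ
  | mul_X P i hP => simpa using hP.mul (hf i)

theorem contDiff_charpoly_coeff (d k : ℕ) :
    ContDiff ℝ ∞ fun A : Matrix (Fin d) (Fin d) ℝ => A.charpoly.coeff k := by
  have h : ∀ A : Matrix (Fin d) (Fin d) ℝ, A.charpoly.coeff k =
      MvPolynomial.eval (fun p : Fin d × Fin d => A p.1 p.2)
        ((Matrix.charpoly.univ ℝ (Fin d)).coeff k) := fun A =>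
    (Matrix.charpoly.univ_coeff_eval₂Hom (Fin d) (RingHom.id ℝ)
      (fun p : Fin d × Fin d => A p.1 p.2) k).symm
  simp only [h]
  refine contDiff_eval_mvPolynomial (fun p => ?_) _
  exact contDiff_comp_linearMap (F := fun x : ℝ => x) contDiff_id (Matrix.entryLinearMap ℝ ℝ p.1 p.2)

/-- A symmetric polynomial in the eigenvalues extends to a smooth function of matrices that is
invariant under cyclic permutation of products. -/
theorem exists_contDiff_mul_comm_eq_eval_isSymmetric {d : ℕ} {P : MvPolynomial (Fin d) ℝ}
    (hP : P.IsSymmetric) :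
    ∃ G : Matrix (Fin d) (Fin d) ℝ → ℝ, ContDiff ℝ ∞ G ∧ (∀ A B, G (A * B) = G (B * A)) ∧
      ∀ r, G (diagonalVec d r) = MvPolynomial.eval (fun i => r i) P := by
  obtain ⟨Q, hQ⟩ := MvPolynomial.esymmAlgHom_surjective (σ := Fin d) ℝ (n := d) (by simp) ⟨P, hP⟩
  have hPQ : P = MvPolynomial.aeval (fun i : Fin d => MvPolynomial.esymm (Fin d) ℝ (i + 1)) Q := by
    rw [← MvPolynomial.esymmAlgHom_apply, hQ]
  refine ⟨fun A => MvPolynomial.eval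
    (fun i : Fin d => (-1) ^ (i + 1 : ℕ) * A.charpoly.coeff (d - (i + 1))) Q, ?_, ?_, ?_⟩
  · exact contDiff_eval_mvPolynomial
      (fun i : Fin d => contDiff_const.mul (contDiff_charpoly_coeff d (d - (i + 1)))) Q
  · intro A B
    simp only [Matrix.charpoly_mul_comm]
  · intro r
    have hr : ∀ i : Fin d, (-1) ^ (i + 1 : ℕ) * (diagonalVec d r).charpoly.coeff (d - (i + 1)) =
        MvPolynomial.eval (fun i => r i) (MvPolynomial.esymm (Fin d) ℝ (i + 1)) := by
      intro i
      have h1 : (diagonalVec d r).charpoly =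
          ((Finset.univ.val.map fun i => r i).map fun t => Polynomial.X - Polynomial.C t).prod := by
        rw [diagonalVec_apply, Matrix.charpoly_diagonal, Multiset.map_map]
        rfl
      have h2 := MvPolynomial.aeval_esymm_eq_multiset_esymm (σ := Fin d) (R := ℝ) (S := ℝ)
        (i + 1) fun i => r i
      rw [h1, Multiset.prod_X_sub_C_coeff _ (by simp), ← MvPolynomial.coe_aeval_eq_eval]
      simp only [Multiset.card_map, Finset.card_val, Finset.card_univ, Fintype.card_fin]
      rw [Nat.sub_sub_self (by omega), ← mul_assoc, ← pow_add, ← two_mul, pow_mul]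
      simpa using h2.symm
    simp only [hr]
    rw [hPQ, ← MvPolynomial.coe_aeval_eq_eval, ← MvPolynomial.coe_aeval_eq_eval, RingHom.coe_coe,
      RingHom.coe_coe, ← MvPolynomial.comp_aeval_apply]

end SymmetricPolynomials

section PolynomialApproximation

open MeasureTheory
open scoped Convolution

theorem dirDeriv_eqOn_of_isOpen {E : Type*} [NormedAddCommGroup E] [NormedSpace ℝ E]
    {F G : E → ℝ} {U : Set E} (hU : IsOpen U) (h : EqOn F G U) (L : List E) :
    EqOn (dirDeriv L F) (dirDeriv L G) U := by
  induction L with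
  | nil => exact h
  | cons v L ih =>
    intro x hx
    have : dirDeriv L F =ᶠ[𝓝 x] dirDeriv L G := ih.eventuallyEq_of_mem (hU.mem_nhds hx)
    simp only [dirDeriv, this.fderiv_eq]

theorem hasCompactSupport_dirDeriv {E : Type*} [NormedAddCommGroup E] [NormedSpace ℝ E]
    {g : E → ℝ} (hg : HasCompactSupport g) (L : List E) : HasCompactSupport (dirDeriv L g) := by
  induction L with
  | nil => exact hg
  | cons v L ih => exact ih.fderiv_apply (𝕜 := ℝ) v

theorem exists_norm_sub_le_add_mul_norm {E F : Type*} [NormedAddCommGroup E] [NormedAddCommGroup F] {Γ : E → F}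
    (hΓ : Continuous Γ) (hc : HasCompactSupport Γ) {ε : ℝ} (hε : 0 < ε) :
    ∃ C, 0 ≤ C ∧ ∀ x t, ‖Γ (x - t) - Γ x‖ ≤ ε + C * ‖t‖ := by
  obtain ⟨B, hB⟩ := hc.exists_bound_of_continuous hΓ
  have hB0 : 0 ≤ B := (norm_nonneg _).trans (hB 0)
  obtain ⟨δ, hδ, h⟩ := Metric.uniformContinuous_iff.1 (hc.uniformContinuous_of_continuous hΓ) ε hε
  refine ⟨2 * B / δ, by positivity, fun x t => ?_⟩
  rcases lt_or_ge ‖t‖ δ with ht | ht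
  · have := h (a := x - t) (b := x) (by simpa [dist_eq_norm] using ht)
    rw [dist_eq_norm] at this
    have : 0 ≤ 2 * B / δ * ‖t‖ := by positivity
    linarith
  · have h1 : 2 * B ≤ 2 * B / δ * ‖t‖ := by
      rw [div_mul_eq_mul_div, le_div_iff₀ hδ]
      gcongr
    have := norm_sub_le (Γ (x - t)) (Γ x)
    linarith [hB (x - t), hB x]

variable {d : ℕ}

theorem dirDeriv_convolution {n : ℕ} {f g : EuclideanSpace ℝ (Fin d) → ℝ} (hf : LocallyIntegrable f)
    (hg : ContDiff ℝ n g) (hgc : HasCompactSupport g) (L : List (EuclideanSpace ℝ (Fin d))) (hL : L.length ≤ n) :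
    dirDeriv L (f ⋆[ContinuousLinearMap.lsmul ℝ ℝ, volume] g) =
      f ⋆[ContinuousLinearMap.lsmul ℝ ℝ, volume] (dirDeriv L g) := by
  induction L with
  | nil => rfl
  | cons v L ih =>
    have h1 : ContDiff ℝ 1 (dirDeriv L g) :=
      contDiff_dirDeriv_of_length_add_le (m := 1) hg L (by simpa using hL)
    have hc := hasCompactSupport_dirDeriv hgc L
    funext x
    simp only [dirDeriv]
    rw [ih (by simp at hL; omega), (hc.hasFDerivAt_convolution_right _ hf h1 x).fderiv,
      convolution_precompR_apply (L := ContinuousLinearMap.lsmul ℝ ℝ) hf (hc.fderiv ℝ) (h1.continuous_fderiv (by simp))]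


theorem abs_indicator_convolution_sub_le {s : Set (EuclideanSpace ℝ (Fin d))} (hs : IsCompact s)
    {w Γ : EuclideanSpace ℝ (Fin d) → ℝ} (hw : Continuous w) (hw0 : ∀ t ∈ s, 0 ≤ w t)
    (hw1 : ∫ t in s, w t = 1) (hΓ : Continuous Γ) {ε C : ℝ} {x : EuclideanSpace ℝ (Fin d)}
    (h : ∀ t, |Γ (x - t) - Γ x| ≤ ε + C * ‖t‖) :
    |(s.indicator w ⋆[ContinuousLinearMap.lsmul ℝ ℝ, volume] Γ) x - Γ x| ≤
      ε + C * ∫ t in s, w t * ‖t‖ := by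
  have hi : ∀ {u : EuclideanSpace ℝ (Fin d) → ℝ}, Continuous u → IntegrableOn u s :=
    fun hu => hu.continuousOn.integrableOn_compact hs
  have h1 : (s.indicator w ⋆[ContinuousLinearMap.lsmul ℝ ℝ, volume] Γ) x =
      ∫ t in s, w t * Γ (x - t) := by
    rw [convolution_lsmul, ← integral_indicator hs.measurableSet]
    congr 1
    funext t
    by_cases ht : t ∈ s <;> simp [ht]
  have h2 : Γ x = ∫ t in s, w t * Γ x := by rw [integral_mul_const, hw1, one_mul]
  have h3 : ε + C * ∫ t in s, w t * ‖t‖ = ∫ t in s, w t * (ε + C * ‖t‖) := by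
    have : ∀ t, w t * (ε + C * ‖t‖) = w t * ε + C * (w t * ‖t‖) := fun t => by ring
    simp only [this]
    rw [integral_add (hi (by fun_prop)) (hi (by fun_prop)), integral_mul_const,
      integral_const_mul, hw1, one_mul]
  rw [h1, h3]
  nth_rw 1 [h2]
  rw [← integral_sub (hi (by fun_prop)) (hi (by fun_prop)), ← Real.norm_eq_abs]
  refine (norm_integral_le_integral_norm _).trans
    (setIntegral_mono_on (hi (by fun_prop)) (hi (by fun_prop)) hs.measurableSet fun t ht => ?_)
  rw [← mul_sub, norm_mul, Real.norm_of_nonneg (hw0 t ht)]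
  exact mul_le_mul_of_nonneg_left (h t) (hw0 t ht)

/-- The normalized kernel `(ρ² - ‖t‖²) ^ N` on the closed ball of radius `ρ`. -/
noncomputable def ballKernel (d : ℕ) (ρ : ℝ) (N : ℕ) (t : EuclideanSpace ℝ (Fin d)) : ℝ :=
  (∫ z in Metric.closedBall (0 : EuclideanSpace ℝ (Fin d)) ρ, (ρ ^ 2 - ‖z‖ ^ 2) ^ N)⁻¹ *
    (ρ ^ 2 - ‖t‖ ^ 2) ^ N

theorem continuous_ballKernel (ρ : ℝ) (N : ℕ) : Continuous (ballKernel d ρ N) := by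
  unfold ballKernel
  fun_prop

theorem ballKernel_nonneg {ρ : ℝ} (N : ℕ) {t : EuclideanSpace ℝ (Fin d)}
    (ht : t ∈ Metric.closedBall 0 ρ) : 0 ≤ ballKernel d ρ N t := by
  have h : ∀ z ∈ Metric.closedBall (0 : EuclideanSpace ℝ (Fin d)) ρ,
      0 ≤ (ρ ^ 2 - ‖z‖ ^ 2) ^ N := fun z hz => by
    have hz := mem_closedBall_zero_iff.1 hz
    exact pow_nonneg (by nlinarith [norm_nonneg z]) N
  exact mul_nonneg (inv_nonneg.2 (setIntegral_nonneg measurableSet_closedBall h)) (h t ht)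

theorem tendsto_setIntegral_ballKernel_mul {ρ : ℝ} (hρ : 0 < ρ)
    {u : EuclideanSpace ℝ (Fin d) → ℝ} (hu : Continuous u) :
    Tendsto (fun N => ∫ t in Metric.closedBall 0 ρ, ballKernel d ρ N t * u t) atTop
      (𝓝 (u 0)) := by
  have := tendsto_setIntegral_pow_smul_of_unique_maximum_of_isCompact_of_continuousOn
    (μ := volume) (x₀ := 0) (isCompact_closedBall (0 : EuclideanSpace ℝ (Fin d)) ρ)
    (c := fun t => ρ ^ 2 - ‖t‖ ^ 2) (by fun_prop) ?_ ?_ (by simpa using pow_pos hρ 2) ?_ hu.continuousOn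
  · refine this.congr fun N => ?_
    simp only [ballKernel, mul_assoc, integral_const_mul, smul_eq_mul]
  · intro y _ hy
    have := norm_pos_iff.2 hy
    simpa using by positivity
  · intro y hy
    have hy := mem_closedBall_zero_iff.1 hy
    nlinarith [norm_nonneg y]
  · exact subset_closure (Metric.ball_subset_interior_closedBall (Metric.mem_ball_self hρ))

theorem eventually_setIntegral_ballKernel_eq_one {ρ : ℝ} (hρ : 0 < ρ) :
    ∀ᶠ N in atTop, ∫ t in Metric.closedBall 0 ρ, ballKernel d ρ N t = 1 := by
  have h := tendsto_setIntegral_ballKernel_mul (d := d) hρ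
    (continuous_const (y := (1 : ℝ)))
  filter_upwards [h.eventually_ne one_ne_zero] with N hN
  simp only [mul_one, ballKernel, integral_const_mul] at hN ⊢
  exact inv_mul_cancel₀ (right_ne_zero_of_mul hN)

end PolynomialApproximation

section KernelPolynomial

open MeasureTheory
open scoped Convolution

variable {d : ℕ}

theorem eventually_abs_dirDeriv_convolution_sub_le {n : ℕ} {g : EuclideanSpace ℝ (Fin d) → ℝ}
    (hg : ContDiff ℝ n g) (hgc : HasCompactSupport g) {ρ : ℝ} (hρ : 0 < ρ) {ε : ℝ} (hε : 0 < ε) :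
    ∀ᶠ N in atTop, ∀ L : List (EuclideanSpace ℝ (Fin d)), L.length ≤ n → (∀ u ∈ L, ‖u‖ ≤ 1) →
      ∀ x, |dirDeriv L ((Metric.closedBall 0 ρ).indicator (ballKernel d ρ N)
        ⋆[ContinuousLinearMap.lsmul ℝ ℝ, volume] g) x - dirDeriv L g x| ≤ ε := by
  have hk : ∀ k ∈ Finset.range (n + 1), ∀ᶠ N in atTop, ∀ L : List (EuclideanSpace ℝ (Fin d)),
      L.length = k → (∀ u ∈ L, ‖u‖ ≤ 1) →
      ∀ x, |((Metric.closedBall 0 ρ).indicator (ballKernel d ρ N)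
        ⋆[ContinuousLinearMap.lsmul ℝ ℝ, volume] dirDeriv L g) x - dirDeriv L g x| ≤ ε := by
    intro k hk
    have hkn : k ≤ n := by simpa [Nat.lt_succ_iff] using hk
    have hcont := hg.continuous_iteratedFDeriv (m := k) (by exact_mod_cast hkn)
    obtain ⟨C, hC, h⟩ := exists_norm_sub_le_add_mul_norm hcont (hgc.iteratedFDeriv (𝕜 := ℝ) k)
      (half_pos hε)
    have hlim := (tendsto_setIntegral_ballKernel_mul (d := d) hρ continuous_norm).const_mul C
    rw [norm_zero, mul_zero] at hlim
    filter_upwards [eventually_setIntegral_ballKernel_eq_one hρ,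
      hlim.eventually_le_const (half_pos hε)] with N hN1 hN L hL hu x
    have hΓ : Continuous (dirDeriv L g) :=
      (contDiff_dirDeriv_of_length_add_le (m := 0) hg L (by omega)).continuous
    refine (abs_indicator_convolution_sub_le (isCompact_closedBall _ ρ)
      (continuous_ballKernel ρ N) (fun t => ballKernel_nonneg N) hN1 hΓ (ε := ε / 2) (C := C)
      fun t => ?_).trans (by linarith)
    rw [dirDeriv_eq_iteratedFDeriv hg L (by omega), dirDeriv_eq_iteratedFDeriv hg L (by omega)]
    subst hL
    rw [← _root_.sub_apply, ← Real.norm_eq_abs]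
    refine (ContinuousMultilinearMap.le_opNorm _ _).trans ((mul_le_of_le_one_right
      (norm_nonneg _) (Finset.prod_le_one (fun _ _ => norm_nonneg _) fun i _ => ?_)).trans (h x t))
    exact hu _ (L.get_mem i)
  filter_upwards [(Finset.range (n + 1)).eventually_all.2 hk] with N hN L hL hu x
  rw [dirDeriv_convolution _ hg hgc L hL]
  · exact hN L.length (by simpa [Nat.lt_succ_iff] using hL) L rfl hu x
  · exact (((continuous_ballKernel ρ N).continuousOn.integrableOn_compact
      (isCompact_closedBall _ ρ)).integrable_indicator measurableSet_closedBall).locallyIntegrable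

theorem exists_eval_eq_integral_ballKernel_mul {g : EuclideanSpace ℝ (Fin d) → ℝ}
    (hg : Continuous g) (hgc : HasCompactSupport g) (ρ : ℝ) (N : ℕ) :
    ∃ P : MvPolynomial (Fin d) ℝ, ∀ x : EuclideanSpace ℝ (Fin d),
      MvPolynomial.eval (fun i => x i) P = ∫ t, ballKernel d ρ N (x - t) * g t := by
  let coord : Fin d → C(EuclideanSpace ℝ (Fin d), ℝ) := fun i => ⟨fun t => t i, by fun_prop⟩
  let c := (∫ z in Metric.closedBall (0 : EuclideanSpace ℝ (Fin d)) ρ, (ρ ^ 2 - ‖z‖ ^ 2) ^ N)⁻¹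
  let Q : MvPolynomial (Fin d) C(EuclideanSpace ℝ (Fin d), ℝ) :=
    MvPolynomial.C (ContinuousMap.const _ c) * (MvPolynomial.C (ContinuousMap.const _ (ρ ^ 2)) -
      ∑ i, (MvPolynomial.X i - MvPolynomial.C (coord i)) ^ 2) ^ N
  have hQ : ∀ x t : EuclideanSpace ℝ (Fin d), ballKernel d ρ N (x - t) =
      ∑ m ∈ Q.support, Q.coeff m t * ∏ i ∈ m.support, x i ^ m i := by
    intro x t
    have h1 : MvPolynomial.eval₂Hom ((Pi.evalRingHom _ t).comp ContinuousMap.coeFnRingHom) (fun i => x i) Q =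
        ballKernel d ρ N (x - t) := by
      simp only [Q, map_mul, map_pow, map_sub, map_sum, MvPolynomial.eval₂Hom_C,
        MvPolynomial.eval₂Hom_X']
      simp [ballKernel, c, coord, EuclideanSpace.norm_sq_eq]
    rw [← h1, MvPolynomial.coe_eval₂Hom, MvPolynomial.eval₂_eq]
    rfl
  refine ⟨∑ m ∈ Q.support, MvPolynomial.monomial m (∫ t, Q.coeff m t * g t), fun x => ?_⟩
  simp only [hQ, Finset.sum_mul]
  rw [integral_finsetSum, map_sum]
  · refine Finset.sum_congr rfl fun m _ => ?_
    rw [MvPolynomial.eval_monomial, ← integral_mul_const]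
    congr 1
    funext t
    simp only [Finsupp.prod]
    ring
  · intro m _
    refine Continuous.integrable_of_hasCompactSupport ?_ hgc.mul_left
    have := (Q.coeff m).continuous
    fun_prop

theorem isSymmetric_of_eval_eq_integral_ballKernel_mul {g : EuclideanSpace ℝ (Fin d) → ℝ}
    (hg : ∀ (σ : Equiv.Perm (Fin d)) (x : EuclideanSpace ℝ (Fin d)),
      g (WithLp.toLp 2 fun i => x (σ i)) = g x) {ρ : ℝ} {N : ℕ} {P : MvPolynomial (Fin d) ℝ}
    (hP : ∀ x : EuclideanSpace ℝ (Fin d),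
      MvPolynomial.eval (fun i => x i) P = ∫ t, ballKernel d ρ N (x - t) * g t) :
    P.IsSymmetric := by
  intro σ
  refine MvPolynomial.funext fun y => ?_
  let e := LinearIsometryEquiv.piLpCongrLeft 2 ℝ ℝ σ.symm
  have he : ∀ x : EuclideanSpace ℝ (Fin d), e x = WithLp.toLp 2 fun i => x (σ i) := fun x => rfl
  have h1 := hP (e (WithLp.toLp 2 y))
  have h2 := hP (WithLp.toLp 2 y)
  rw [MvPolynomial.eval_rename]
  refine Eq.trans h1 (Eq.trans ?_ h2.symm)
  rw [← (LinearIsometryEquiv.measurePreserving e).integral_comp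
    e.toHomeomorph.measurableEmbedding]
  congr 1
  funext t
  rw [← map_sub, ← hg σ t, ← he]
  simp only [ballKernel, LinearIsometryEquiv.norm_map]

end KernelPolynomial

section SymmetricApproximation

open MeasureTheory
open scoped Convolution

variable {d : ℕ}

/-- A symmetric `C^n` function is approximated by symmetric polynomials in the `C^n` topology. -/
theorem exists_isSymmetric_abs_dirDeriv_sub_le {n : ℕ} {f : EuclideanSpace ℝ (Fin d) → ℝ}
    (hf : ContDiff ℝ n f) (hsymm : ∀ (σ : Equiv.Perm (Fin d)) (x : EuclideanSpace ℝ (Fin d)),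
      f (WithLp.toLp 2 fun i => x (σ i)) = f x) {R : ℝ} (hR : 0 ≤ R) {ε : ℝ} (hε : 0 < ε) :
    ∃ P : MvPolynomial (Fin d) ℝ, P.IsSymmetric ∧
      ∀ L : List (EuclideanSpace ℝ (Fin d)), L.length ≤ n → (∀ u ∈ L, ‖u‖ ≤ 1) →
        ∀ x ∈ Metric.closedBall (0 : EuclideanSpace ℝ (Fin d)) R,
          |dirDeriv L (fun x : EuclideanSpace ℝ (Fin d) =>
            MvPolynomial.eval (fun i => x i) P) x - dirDeriv L f x| ≤ ε := by
  let g : EuclideanSpace ℝ (Fin d) → ℝ := fun x =>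
    Real.smoothTransition ((R + 2) ^ 2 - ‖x‖ ^ 2) * f x
  have hgf : EqOn g f (Metric.ball 0 (R + 1)) := fun x hx => by
    have hx := mem_ball_zero_iff.1 hx
    simp only [g]
    rw [Real.smoothTransition.one_of_one_le (by nlinarith [norm_nonneg x]), one_mul]
  have hg0 : ∀ x, x ∉ Metric.closedBall (0 : EuclideanSpace ℝ (Fin d)) (R + 2) → g x = 0 := by
    intro x hx
    rw [mem_closedBall_zero_iff, not_le] at hx
    simp only [g]
    rw [Real.smoothTransition.zero_of_nonpos (by nlinarith [norm_nonneg x]), zero_mul]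
  have hg : ContDiff ℝ n g :=
    (Real.smoothTransition.contDiff.comp (contDiff_const.sub (contDiff_norm_sq ℝ))).mul hf
  have hgc : HasCompactSupport g := HasCompactSupport.intro (isCompact_closedBall _ _) hg0
  have hgs : ∀ (σ : Equiv.Perm (Fin d)) (x : EuclideanSpace ℝ (Fin d)),
      g (WithLp.toLp 2 fun i => x (σ i)) = g x := by
    intro σ x
    have : ‖WithLp.toLp 2 fun i => x (σ i)‖ = ‖x‖ :=
      (LinearIsometryEquiv.piLpCongrLeft 2 ℝ ℝ σ.symm).norm_map x
    simp only [g, this, hsymm]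
  obtain ⟨N, hN⟩ := (eventually_abs_dirDeriv_convolution_sub_le hg hgc
    (show 0 < 2 * R + 3 by positivity) hε).exists
  obtain ⟨P, hP⟩ := exists_eval_eq_integral_ballKernel_mul hg.continuous hgc (2 * R + 3) N
  refine ⟨P, isSymmetric_of_eval_eq_integral_ballKernel_mul hgs hP, fun L hL hu x hx => ?_⟩
  have hx' : x ∈ Metric.ball (0 : EuclideanSpace ℝ (Fin d)) (R + 1) :=
    Metric.closedBall_subset_ball (by linarith) hx
  have hPg : EqOn (fun x : EuclideanSpace ℝ (Fin d) => MvPolynomial.eval (fun i => x i) P)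
      ((Metric.closedBall 0 (2 * R + 3)).indicator (ballKernel d (2 * R + 3) N)
        ⋆[ContinuousLinearMap.lsmul ℝ ℝ, volume] g) (Metric.ball 0 (R + 1)) := by
    intro y hy
    simp only [hP, convolution_lsmul_swap]
    congr 1
    funext t
    by_cases ht : t ∈ Metric.closedBall (0 : EuclideanSpace ℝ (Fin d)) (R + 2)
    · rw [indicator_of_mem, smul_eq_mul]
      rw [mem_closedBall_zero_iff] at ht ⊢
      linarith [norm_sub_le y t, mem_ball_zero_iff.1 hy]
    · simp [hg0 t ht]
  rw [dirDeriv_eqOn_of_isOpen Metric.isOpen_ball hPg L hx',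
    ← dirDeriv_eqOn_of_isOpen Metric.isOpen_ball hgf L hx']
  exact hN L hL hu x

end SymmetricApproximation

section UniformLimit

/-- A pointwise limit of `C^n` functions whose derivatives up to order `n` are uniformly Cauchy on
an open set is `C^n` there. -/
theorem contDiffOn_of_uniformCauchySeqOn_iteratedFDeriv {E G : Type*} [NormedAddCommGroup E]
    [NormedSpace ℝ E] [NormedAddCommGroup G] [NormedSpace ℝ G] [CompleteSpace G] {n : ℕ}
    {u : ℕ → E → G} {f : E → G} {s : Set E} (hs : IsOpen s) (hu : ∀ j, ContDiff ℝ n (u j))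
    (hcauchy : ∀ k ≤ n, UniformCauchySeqOn (fun j => iteratedFDeriv ℝ k (u j)) atTop s)
    (hlim : ∀ x ∈ s, Tendsto (fun j => u j x) atTop (𝓝 (f x))) : ContDiffOn ℝ n f s := by
  let p : E → FormalMultilinearSeries ℝ E G := fun x k =>
    limUnder atTop fun j => iteratedFDeriv ℝ k (u j) x
  have hp : ∀ k ≤ n, TendstoUniformlyOn (fun j => iteratedFDeriv ℝ k (u j)) (fun x => p x k)
      atTop s := fun k hk => (hcauchy k hk).tendstoUniformlyOn_of_tendsto fun x hx =>
    ((hcauchy k hk).cauchySeq hx).tendsto_limUnder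
  have hseries : HasFTaylorSeriesUpToOn (n : ℕ∞) f p s := by
    refine ⟨fun x hx => ?_, fun m hm x hx => ?_, fun m hm => ?_⟩
    · refine tendsto_nhds_unique ?_ (hlim x hx)
      have h := ((hp 0 n.zero_le).tendsto_at hx)
      have := ((continuousMultilinearCurryFin0 ℝ E G).continuous.tendsto _).comp h
      refine this.congr fun j => ?_
      simp
    · have hm : m < n := by exact_mod_cast hm
      refine HasFDerivAt.hasFDerivWithinAt ?_
      refine hasFDerivAt_of_tendstoUniformlyOn (l := atTop)
        (f := fun j => iteratedFDeriv ℝ m (u j))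
        (f' := fun j x => (iteratedFDeriv ℝ (m + 1) (u j) x).curryLeft)
        (g' := fun x => (p x (m + 1)).curryLeft) hs ?_
        (fun j y _ => (hu j).ftaylorSeries.fderiv m (by exact_mod_cast hm) y)
        (fun y hy => (hp m hm.le).tendsto_at hy) hx
      exact (continuousMultilinearCurryLeftEquiv ℝ (fun _ : Fin (m + 1) => E)
        G).isometry.uniformContinuous.comp_tendstoUniformlyOn (hp (m + 1) hm)
    · have hm : m ≤ n := by exact_mod_cast hm
      exact (hp m hm).continuousOn (Eventually.of_forall fun j =>
        ((hu j).continuous_iteratedFDeriv (by exact_mod_cast hm)).continuousOn).frequently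
  exact hseries.contDiffOn

end UniformLimit

section RotationInvariant

variable {d : ℕ}

theorem norm_iteratedFDeriv_subtype_le {k : ℕ} {C : ℝ} (hC : 0 ≤ C)
    {G : Matrix (Fin d) (Fin d) ℝ → ℝ} (hG : ContDiff ℝ ∞ G) {A : SymMat d}
    (h : ∀ L : List (Matrix (Fin d) (Fin d) ℝ), L.length = k →
      (∀ H ∈ L, H.IsSymm ∧ ‖H‖ ≤ 1) → |dirDeriv L G A| ≤ C) :
    ‖iteratedFDeriv ℝ k (fun B : SymMat d => G B) A‖ ≤ C := by
  refine norm_iteratedFDeriv_le_of_dirDeriv (contDiff_comp_linearMap hG (SymMat d).subtype) hC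
    fun L hLk hL => ?_
  rw [dirDeriv_comp_linearMap hG (SymMat d).subtype L]
  refine h _ (by simpa using hLk) fun H hH => ?_
  obtain ⟨B, hB, rfl⟩ := List.mem_map.1 hH
  exact ⟨B.2, hL B hB⟩

theorem contDiffOn_ball_of_diagonal_restriction {n : ℕ} {F : SymMat d → ℝ}
    (hinv : ∀ g : Matrix (Fin d) (Fin d) ℝ, g * gᵀ = 1 → ∀ x y : SymMat d,
      (y : Matrix (Fin d) (Fin d) ℝ) = g * (x : Matrix (Fin d) (Fin d) ℝ) * gᵀ → F y = F x)
    (hdiag : ContDiff ℝ n fun r : EuclideanSpace ℝ (Fin d) =>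
      F ⟨Matrix.diagonal (fun i => r i), Matrix.isSymm_diagonal _⟩) {R : ℝ} (hR : 0 ≤ R) :
    ContDiffOn ℝ n F (Metric.ball 0 R) := by
  let f : EuclideanSpace ℝ (Fin d) → ℝ := fun r =>
    F ⟨Matrix.diagonal (fun i => r i), Matrix.isSymm_diagonal _⟩
  have hsymm : ∀ (σ : Equiv.Perm (Fin d)) (x : EuclideanSpace ℝ (Fin d)),
      f (WithLp.toLp 2 fun i => x (σ i)) = f x := by
    intro σ x
    refine hinv (σ.permMatrix ℝ) ?_ _ _ ?_
    · rw [Matrix.transpose_permMatrix, ← Matrix.permMatrix_mul]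
      simp
    · rw [Matrix.transpose_permMatrix, Equiv.Perm.permMatrix, Equiv.Perm.permMatrix,
        PEquiv.toMatrix_toPEquiv_mul, PEquiv.mul_toMatrix_toPEquiv]
      ext i j
      simp [Matrix.diagonal_apply, Equiv.Perm.inv_def]
  choose P hPs hP using fun j : ℕ =>
    exists_isSymmetric_abs_dirDeriv_sub_le (f := f) hdiag hsymm hR (Nat.one_div_pos_of_nat (n := j))
  choose G hG htr hGP using fun j => exists_contDiff_mul_comm_eq_eval_isSymmetric (hPs j)
  have hPG : ∀ j, (fun x : EuclideanSpace ℝ (Fin d) => MvPolynomial.eval (fun i => x i) (P j)) =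
      fun x => G j (diagonalVec d x) := fun j => funext fun x => (hGP j x).symm
  have hGd : ∀ j, ContDiff ℝ ∞ fun x => G j (diagonalVec d x) := fun j =>
    contDiff_comp_linearMap (hG j) (diagonalVec d)
  have hGs : ∀ j, ContDiff ℝ ∞ fun A : SymMat d => G j A := fun j =>
    contDiff_comp_linearMap (hG j) (SymMat d).subtype
  simp only [hPG] at hP
  refine contDiffOn_of_uniformCauchySeqOn_iteratedFDeriv (u := fun j (A : SymMat d) => G j A)
    Metric.isOpen_ball (fun j => (hGs j).of_le (by exact_mod_cast le_top)) (fun k hk => ?_)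
    fun A hA => ?_
  · obtain ⟨C, hC, hbound⟩ := exists_abs_dirDeriv_isSymm_le d k
    rw [Metric.uniformCauchySeqOn_iff]
    intro ε hε
    obtain ⟨N, hN⟩ := exists_nat_gt (C * 2 / ε)
    refine ⟨N, fun m hm l hl A hA => ?_⟩
    have hN0 : (0 : ℝ) < N + 1 := by positivity
    have hsmall : C * (2 / (N + 1)) < ε := by
      rw [← mul_div_assoc, div_lt_comm₀ hN0 hε]
      linarith
    refine lt_of_le_of_lt ?_ hsmall
    have hk' : ∀ j, ContDiffAt ℝ k (fun A : SymMat d => G j A) A := fun j =>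
      ((hGs j).of_le (by exact_mod_cast le_top)).contDiffAt
    rw [dist_eq_norm, ← iteratedFDeriv_sub_apply (hk' m) (hk' l)]
    refine norm_iteratedFDeriv_subtype_le (G := fun B => G m B - G l B) (by positivity)
      ((hG m).sub (hG l)) ?_
    refine hbound _ ((hG m).sub (hG l)) (fun B B' => by simp only [htr _ B]) R _ (by positivity)
      (fun x hx L hL hu => ?_) A A.2 (mem_ball_zero_iff.1 hA).le
    rw [dirDeriv_sub (hGd m) (hGd l)]
    have h1 := hP m L (hL.trans_le hk) hu x hx
    have h2 := hP l L (hL.trans_le hk) hu x hx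
    have h3 : (1 : ℝ) / (m + 1) ≤ 1 / (N + 1) := by gcongr
    have h4 : (1 : ℝ) / (l + 1) ≤ 1 / (N + 1) := by gcongr
    have h5 : (2 : ℝ) / (N + 1) = 1 / (N + 1) + 1 / (N + 1) := by ring
    rw [abs_le] at h1 h2 ⊢
    constructor <;> linarith [h1.1, h1.2, h2.1, h2.2]
  · obtain ⟨g, r, hg, hg', hgr⟩ := exists_eq_conj_diagonalVec A.2
    have hFA : F A = f r := hinv g hg _ _ hgr
    have hGA : ∀ j, G j A = G j (diagonalVec d r) := fun j => by
      rw [hgr, htr, ← Matrix.mul_assoc, hg', Matrix.one_mul]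
    have hr : r ∈ Metric.closedBall (0 : EuclideanSpace ℝ (Fin d)) R := by
      rw [mem_closedBall_zero_iff, ← norm_diagonalVec, ← frobenius_norm_conj hg', ← hgr]
      exact (mem_ball_zero_iff.1 hA).le
    simp only [hFA, hGA]
    refine tendsto_iff_dist_tendsto_zero.2 (squeeze_zero (fun _ => dist_nonneg) (fun j => ?_)
      tendsto_one_div_add_atTop_nhds_zero_nat)
    exact hP j [] (Nat.zero_le n) (by simp) r hr

end RotationInvariant

end

/-- A rotation-invariant function on the real symmetric matrices whose restriction to the
diagonal matrices is `C^n` is itself `C^n`. -/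
theorem rotation_invariant_contDiff_of_diagonal_restriction
    (d n : ℕ) (F : SymMat d → ℝ)
    (hinv : ∀ g : Matrix (Fin d) (Fin d) ℝ, g * gᵀ = 1 →
      ∀ x y : SymMat d, (y : Matrix (Fin d) (Fin d) ℝ) = g * (x : Matrix (Fin d) (Fin d) ℝ) * gᵀ →
        F y = F x)
    (hdiag : ContDiff ℝ n fun r : EuclideanSpace ℝ (Fin d) =>
      F ⟨Matrix.diagonal (fun i => r i), Matrix.isSymm_diagonal _⟩) :
    ContDiff ℝ n F := by
  refine contDiff_iff_contDiffAt.2 fun A => ?_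
  refine (contDiffOn_ball_of_diagonal_restriction hinv hdiag (R := ‖A‖ + 1)
    (by positivity)).contDiffAt (Metric.isOpen_ball.mem_nhds ?_)
  exact mem_ball_zero_iff.2 (lt_add_one _)
end

section
/- Let F be a rotation-invariant function on the space of real d×d symmetric matrices. If the restriction of F to the diagonal matrices is C^∞, then F is C^∞. -/
open Matrix

attribute [local instance] Matrix.frobeniusNormedAddCommGroup Matrix.frobeniusNormedSpace

open MeasureTheory in
/-- Differentiation under the integral sign, to all orders. -/
theorem contDiff_integral_of_dominated {X E V : Type}
    [NormedAddCommGroup X] [NormedSpace ℝ X] [MeasurableSpace X] [BorelSpace X]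
    [SecondCountableTopology X]
    [NormedAddCommGroup E] [NormedSpace ℝ E]
    [NormedAddCommGroup V] [NormedSpace ℝ V] (μ : Measure X) (n : ℕ) (G : X → E → V)
    (hG : ContDiff ℝ (⊤ : ℕ∞) (Function.uncurry G))
    (hb : ∀ k, ∃ b : X → ℝ, Integrable b μ ∧ ∀ ξ A, ‖iteratedFDeriv ℝ k (G ξ) A‖ ≤ b ξ) :
    ContDiff ℝ n fun A => ∫ ξ, G ξ A ∂μ := by
  induction n generalizing V with
  | zero =>
    obtain ⟨b, hbi, hb⟩ := hb 0
    refine contDiff_zero.2 (continuous_of_dominated (bound := b) (fun A => ?_) (fun A => ?_) hbi ?_)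
    · exact (hG.continuous.comp (by fun_prop : Continuous fun ξ => (ξ, A))).aestronglyMeasurable
    · exact .of_forall fun ξ => by simpa using hb ξ A
    · exact .of_forall fun ξ => hG.continuous.comp (by fun_prop : Continuous fun A => (ξ, A))
  | succ n ih =>
    obtain ⟨b₀, hbi₀, hb₀⟩ := hb 0
    obtain ⟨b₁, hbi₁, hb₁⟩ := hb 1
    have hdiff (ξ : X) : Differentiable ℝ (G ξ) := by
      have : ContDiff ℝ (⊤ : ℕ∞) (G ξ) := hG.comp (by fun_prop : ContDiff ℝ _ fun A : E => (ξ, A))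
      exact this.differentiable (by simp)
    have hG' : ContDiff ℝ (⊤ : ℕ∞) (Function.uncurry fun ξ A => fderiv ℝ (G ξ) A) := by
      refine ContDiff.fderiv (f := fun p : X × E => G p.1) (m := (⊤ : ℕ∞)) ?_ contDiff_snd (by simp)
      exact hG.comp (by fun_prop : ContDiff ℝ _ fun q : (X × E) × E => (q.1.1, q.2))
    have hder (A : E) : HasFDerivAt (fun A => ∫ ξ, G ξ A ∂μ) (∫ ξ, fderiv ℝ (G ξ) A ∂μ) A := by
      have hc (A : E) : Continuous fun ξ : X => (ξ, A) := by fun_prop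
      refine hasFDerivAt_integral_of_dominated_of_fderiv_le (F := fun A ξ => G ξ A)
        (F' := fun A ξ => fderiv ℝ (G ξ) A) (bound := b₁) Filter.univ_mem ?_ ?_ ?_ ?_ hbi₁ ?_
      · exact .of_forall fun A => (hG.continuous.comp (hc A)).aestronglyMeasurable
      · exact hbi₀.mono' (hG.continuous.comp (hc A)).aestronglyMeasurable
          (.of_forall fun ξ => by simpa using hb₀ ξ A)
      · exact (hG'.continuous.comp (hc A)).aestronglyMeasurable
      · refine .of_forall fun ξ A _ => ?_
        have := hb₁ ξ A
        rwa [← zero_add 1, ← norm_iteratedFDeriv_fderiv, norm_iteratedFDeriv_zero] at this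
      · exact .of_forall fun ξ A _ => (hdiff ξ A).hasFDerivAt
    have hfd : fderiv ℝ (fun A => ∫ ξ, G ξ A ∂μ) = fun A => ∫ ξ, fderiv ℝ (G ξ) A ∂μ :=
      funext fun A => (hder A).fderiv
    rw [Nat.cast_add, Nat.cast_one, contDiff_succ_iff_fderiv, hfd]
    refine ⟨fun A => (hder A).differentiableAt, by simp, ih _ hG' fun k => ?_⟩
    obtain ⟨b, hbi, hb⟩ := hb (k + 1)
    exact ⟨b, hbi, fun ξ A => by simpa [norm_iteratedFDeriv_fderiv] using hb ξ A⟩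

/-- If a smooth bounded map `Φ` into a normed algebra satisfies `Φ B = Φ (B / 2) ^ 2`, then all its
derivatives are bounded. -/
theorem exists_norm_iteratedFDeriv_le_of_eq_half_mul_half {E R : Type*}
    [NormedAddCommGroup E] [NormedSpace ℝ E] [ProperSpace E] [NormedRing R] [NormedAlgebra ℝ R]
    {Φ : E → R} (hΦ : ContDiff ℝ (⊤ : ℕ∞) Φ) (h_one : ∀ B, ‖Φ B‖ ≤ 1)
    (h_half : ∀ B, Φ B = Φ ((2⁻¹ : ℝ) • B) * Φ ((2⁻¹ : ℝ) • B)) (k : ℕ) :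
    ∃ C, 0 ≤ C ∧ ∀ B, ‖iteratedFDeriv ℝ k Φ B‖ ≤ C := by
  induction k using Nat.strong_induction_on with
  | _ k ih =>
  rcases Nat.eq_zero_or_pos k with rfl | hk
  · exact ⟨1, zero_le_one, fun B => by simpa using h_one B⟩
  choose! M hM0 hM using ih
  set S : ℝ := ∑ i ∈ Finset.Ico 1 k, (k.choose i : ℝ) * M i * M (k - i) with hS
  have hS0 : 0 ≤ S := Finset.sum_nonneg fun i hi => by
    rw [Finset.mem_Ico] at hi
    have := hM0 i hi.2
    have := hM0 (k - i) (by omega)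
    positivity
  have hstep (B : E) : ‖iteratedFDeriv ℝ k Φ B‖ ≤
      (2⁻¹ : ℝ) ^ k * (2 * ‖iteratedFDeriv ℝ k Φ ((2⁻¹ : ℝ) • B)‖ + S) := by
    set Ψ : E → R := fun B => Φ B * Φ B with hΨ
    have hΨs : ContDiff ℝ (⊤ : ℕ∞) Ψ := hΦ.mul hΦ
    have h1 : Φ = fun B => Ψ ((2⁻¹ : ℝ) • B) := funext h_half
    have h2 : iteratedFDeriv ℝ k Φ B = (2⁻¹ : ℝ) ^ k • iteratedFDeriv ℝ k Ψ ((2⁻¹ : ℝ) • B) := by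
      conv_lhs => rw [h1]
      rw [iteratedFDeriv_comp_const_smul _ (hΨs.of_le (mod_cast le_top))]
    rw [h2, norm_smul, Real.norm_of_nonneg (by positivity)]
    gcongr
    set B' := (2⁻¹ : ℝ) • B
    refine (norm_iteratedFDeriv_mul_le hΦ hΦ B' (mod_cast le_top)).trans ?_
    rw [Finset.sum_range_succ, Finset.range_eq_Ico, Finset.sum_eq_sum_Ico_succ_bot hk]
    have h0 := h_one B'
    have hk0 := norm_nonneg (iteratedFDeriv ℝ k Φ B')
    have hmid : ∑ i ∈ Finset.Ico 1 k, (k.choose i : ℝ) * ‖iteratedFDeriv ℝ i Φ B'‖ *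
        ‖iteratedFDeriv ℝ (k - i) Φ B'‖ ≤ S := by
      refine Finset.sum_le_sum fun i hi => ?_
      rw [Finset.mem_Ico] at hi
      have := hM i hi.2 B'
      have := hM (k - i) (by omega) B'
      have := hM0 i hi.2
      gcongr
    have hkk : ‖iteratedFDeriv ℝ (k - k) Φ B'‖ = ‖Φ B'‖ := by
      rw [Nat.sub_self, norm_iteratedFDeriv_zero]
    simp only [Nat.choose_zero_right, Nat.cast_one, one_mul, norm_iteratedFDeriv_zero,
      zero_add, Nat.choose_self, hkk]
    change ‖Φ B'‖ * ‖iteratedFDeriv ℝ k Φ B'‖ + _ + _ ≤ _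
    nlinarith
  obtain ⟨M₀, hM₀⟩ := (isCompact_closedBall (0 : E) 1).exists_bound_of_continuousOn
    (hΦ.continuous_iteratedFDeriv (m := k) (mod_cast le_top)).continuousOn
  set C := max (max M₀ 0) S with hC
  have hC0 : 0 ≤ C := (le_max_right _ _).trans (le_max_left _ _)
  have hcontr : (2⁻¹ : ℝ) ^ k * (2 * C + S) ≤ C := by
    rcases Nat.lt_or_ge k 2 with h | h
    · obtain rfl : k = 1 := by omega
      have : S = 0 := by simp [hS]
      rw [this]; linarith
    · have h4 : (2⁻¹ : ℝ) ^ k ≤ 2⁻¹ ^ 2 := pow_le_pow_of_le_one (by norm_num) (by norm_num) h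
      have : S ≤ C := le_max_right _ _
      nlinarith
  have hball (n : ℕ) : ∀ B : E, ‖B‖ ≤ 2 ^ n → ‖iteratedFDeriv ℝ k Φ B‖ ≤ C := by
    induction n with
    | zero =>
      intro B hB
      exact (hM₀ B (by simpa using hB)).trans ((le_max_left _ _).trans (le_max_left _ _))
    | succ n ihn =>
      intro B hB
      refine (hstep B).trans (le_trans ?_ hcontr)
      gcongr
      refine ihn _ ?_
      rw [norm_smul, Real.norm_of_nonneg (by positivity)]
      rw [pow_succ] at hB
      linarith
  refine ⟨C, hC0, fun B => ?_⟩
  obtain ⟨n, hn⟩ := pow_unbounded_of_one_lt ‖B‖ (one_lt_two)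
  exact hball n B hn.le

/-- A family of smooth functions whose derivatives are bounded uniformly in space, and polynomially
in the parameter. -/
structure IsModerate {X E V : Type*} [NormedAddCommGroup X] [NormedAddCommGroup E]
    [NormedSpace ℝ E] [NormedAddCommGroup V] [NormedSpace ℝ V] (G : X → E → V) : Prop where
  contDiff : ∀ ξ, ContDiff ℝ (⊤ : ℕ∞) (G ξ)
  bound : ∀ k : ℕ, ∃ (C : ℝ) (m : ℕ), 0 ≤ C ∧
    ∀ ξ A, ‖iteratedFDeriv ℝ k (G ξ) A‖ ≤ C * (1 + ‖ξ‖) ^ m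

namespace IsModerate

variable {X E V W : Type*} [NormedAddCommGroup X] [NormedAddCommGroup E]
    [NormedSpace ℝ E] [NormedAddCommGroup V] [NormedSpace ℝ V]
    [NormedAddCommGroup W] [NormedSpace ℝ W]

theorem const (v : V) : IsModerate fun (_ : X) (_ : E) => v where
  contDiff _ := contDiff_const
  bound k := by
    refine ⟨‖v‖, 0, norm_nonneg v, fun ξ A => ?_⟩
    rcases Nat.eq_zero_or_pos k with rfl | hk
    · simp
    · rw [iteratedFDeriv_const_of_ne hk.ne']
      simp

theorem clm_comp {G : X → E → V} (hG : IsModerate G) (L : V →L[ℝ] W) :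
    IsModerate fun ξ A => L (G ξ A) where
  contDiff ξ := L.contDiff.comp (hG.contDiff ξ)
  bound k := by
    obtain ⟨C, m, hC, h⟩ := hG.bound k
    refine ⟨‖L‖ * C, m, by positivity, fun ξ A => ?_⟩
    refine (L.norm_iteratedFDeriv_comp_left (hG.contDiff ξ).contDiffAt (mod_cast le_top)).trans ?_
    rw [mul_assoc]
    gcongr
    exact h ξ A

theorem add {G H : X → E → V} (hG : IsModerate G) (hH : IsModerate H) :
    IsModerate fun ξ A => G ξ A + H ξ A where
  contDiff ξ := (hG.contDiff ξ).add (hH.contDiff ξ)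
  bound k := by
    obtain ⟨C, m, hC, h⟩ := hG.bound k
    obtain ⟨C', m', hC', h'⟩ := hH.bound k
    refine ⟨C + C', m + m', by positivity, fun ξ A => ?_⟩
    have hg : ContDiffAt ℝ k (G ξ) A := ((hG.contDiff ξ).of_le (mod_cast le_top)).contDiffAt
    have hh : ContDiffAt ℝ k (H ξ) A := ((hH.contDiff ξ).of_le (mod_cast le_top)).contDiffAt
    rw [fun_iteratedFDeriv_add_apply hg hh, add_mul]
    have h1 : 1 ≤ 1 + ‖ξ‖ := by simp
    refine (norm_add_le _ _).trans (add_le_add ((h ξ A).trans ?_) ((h' ξ A).trans ?_))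
    · gcongr
      omega
    · gcongr
      omega

theorem sum {ι : Type*} (s : Finset ι) {G : ι → X → E → V} (hG : ∀ i ∈ s, IsModerate (G i)) :
    IsModerate fun ξ A => ∑ i ∈ s, G i ξ A := by
  classical
  induction s using Finset.induction_on with
  | empty => simpa using const (X := X) (E := E) (0 : V)
  | insert i s hi ih =>
    simp only [Finset.sum_insert hi]
    exact (hG i (by simp)).add (ih fun j hj => hG j (by simp [hj]))

theorem mul {R : Type*} [NormedRing R] [NormedAlgebra ℝ R] {G H : X → E → R}
    (hG : IsModerate G) (hH : IsModerate H) : IsModerate fun ξ A => G ξ A * H ξ A where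
  contDiff ξ := (hG.contDiff ξ).mul (hH.contDiff ξ)
  bound k := by
    choose C m hC h using hG.bound
    choose C' m' hC' h' using hH.bound
    set N := ∑ i ∈ Finset.range (k + 1), (m i + m' (k - i)) with hN
    refine ⟨∑ i ∈ Finset.range (k + 1), (k.choose i : ℝ) * C i * C' (k - i), N,
      Finset.sum_nonneg fun i _ => mul_nonneg (mul_nonneg (by positivity) (hC _)) (hC' _),
      fun ξ A => ?_⟩
    refine (norm_iteratedFDeriv_mul_le (hG.contDiff ξ) (hH.contDiff ξ) A
      (mod_cast le_top)).trans ?_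
    rw [Finset.sum_mul]
    refine Finset.sum_le_sum fun i hi => ?_
    have h1 : 1 ≤ 1 + ‖ξ‖ := by simp
    have hle : m i + m' (k - i) ≤ N :=
      Finset.single_le_sum (f := fun i => m i + m' (k - i)) (fun _ _ => Nat.zero_le _) hi
    have := hC i
    have := hC' (k - i)
    calc (k.choose i : ℝ) * ‖iteratedFDeriv ℝ i (G ξ) A‖ * ‖iteratedFDeriv ℝ (k - i) (H ξ) A‖
        ≤ (k.choose i : ℝ) * (C i * (1 + ‖ξ‖) ^ m i) * (C' (k - i) * (1 + ‖ξ‖) ^ m' (k - i)) := by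
          gcongr
          · exact h i ξ A
          · exact h' (k - i) ξ A
      _ = (k.choose i : ℝ) * C i * C' (k - i) * (1 + ‖ξ‖) ^ (m i + m' (k - i)) := by ring
      _ ≤ _ := by gcongr

theorem prod {R ι : Type*} [NormedCommRing R] [NormedAlgebra ℝ R] (s : Finset ι)
    {G : ι → X → E → R} (hG : ∀ i ∈ s, IsModerate (G i)) :
    IsModerate fun ξ A => ∏ i ∈ s, G i ξ A := by
  classical
  induction s using Finset.induction_on with
  | empty => simpa using const (X := X) (E := E) (1 : R)
  | insert i s hi ih =>
    simp only [Finset.prod_insert hi]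
    exact (hG i (by simp)).mul (ih fun j hj => hG j (by simp [hj]))

theorem det {R n : Type*} [NormedCommRing R] [NormedAlgebra ℝ R] [Fintype n] [DecidableEq n]
    {G : X → E → Matrix n n R} (hG : ∀ i j, IsModerate fun ξ A => G ξ A i j) :
    IsModerate fun ξ A => (G ξ A).det := by
  simp only [Matrix.det_apply']
  exact sum _ fun σ _ => (const _).mul (prod _ fun i _ => hG _ _)

/-- Rescaling a function with bounded derivatives by a linear function of the parameter. -/
theorem comp_smul [NormedSpace ℝ X] {Φ : E → V} (hΦ : ContDiff ℝ (⊤ : ℕ∞) Φ)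
    (hb : ∀ k : ℕ, ∃ C, 0 ≤ C ∧ ∀ B, ‖iteratedFDeriv ℝ k Φ B‖ ≤ C) (l : X →L[ℝ] ℝ) :
    IsModerate fun ξ A => Φ (l ξ • A) where
  contDiff ξ := hΦ.comp (contDiff_const_smul _)
  bound k := by
    obtain ⟨C, hC, h⟩ := hb k
    refine ⟨‖l‖ ^ k * C, k, by positivity, fun ξ A => ?_⟩
    rw [iteratedFDeriv_comp_const_smul _ (hΦ.of_le (mod_cast le_top)), norm_smul, norm_pow]
    have h1 : ‖l ξ‖ ≤ ‖l‖ * (1 + ‖ξ‖) := (l.le_opNorm ξ).trans (by gcongr; simp)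
    calc ‖l ξ‖ ^ k * ‖iteratedFDeriv ℝ k Φ (l ξ • A)‖ ≤ (‖l‖ * (1 + ‖ξ‖)) ^ k * C := by
          gcongr
          exact h _
      _ = _ := by rw [mul_pow]; ring

end IsModerate

/-- Integrating a moderate family against a Schwartz function gives a smooth function. -/
theorem IsModerate.contDiff_integral_mul {X E : Type}
    [NormedAddCommGroup X] [NormedSpace ℝ X] [MeasurableSpace X] [BorelSpace X]
    [SecondCountableTopology X] (μ : MeasureTheory.Measure X) [μ.HasTemperateGrowth]
    [NormedAddCommGroup E] [NormedSpace ℝ E] {G : X → E → ℂ} (hG : IsModerate G)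
    (hGs : ContDiff ℝ (⊤ : ℕ∞) (Function.uncurry G)) (φ : SchwartzMap X ℂ) :
    ContDiff ℝ (⊤ : ℕ∞) fun A => ∫ ξ, φ ξ * G ξ A ∂μ := by
  refine contDiff_infty.2 fun n => contDiff_integral_of_dominated μ n _ ?_ fun k => ?_
  · exact ((φ.smooth _).comp contDiff_fst).mul hGs
  · obtain ⟨C, m, hC, h⟩ := hG.bound k
    refine ⟨fun ξ => C * ∑ i ∈ Finset.range (m + 1), (m.choose i : ℝ) * (‖ξ‖ ^ i * ‖φ ξ‖),
      (MeasureTheory.integrable_finsetSum _ fun i _ =>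
        (φ.integrable_pow_mul μ i).const_mul _).const_mul _, fun ξ A => ?_⟩
    have hL := (ContinuousLinearMap.mul ℝ ℂ (φ ξ)).norm_iteratedFDeriv_comp_left
      (hG.contDiff ξ).contDiffAt (x := A) (n := k) (mod_cast le_top)
    refine hL.trans ?_
    calc _ ≤ ‖φ ξ‖ * (C * (1 + ‖ξ‖) ^ m) := by
          gcongr
          · exact ContinuousLinearMap.opNorm_mul_apply_le ℝ ℂ _
          · exact h ξ A
      _ = _ := by
          rw [add_comm, add_pow]
          simp only [Finset.mul_sum]
          refine Finset.sum_congr rfl fun i _ => ?_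
          simp only [one_pow, mul_one]
          ring

/-- **Ryser's formula** for the permanent. -/
theorem sum_neg_one_pow_card_mul_prod_sum_compl {n R : Type*} [Fintype n] [DecidableEq n]
    [CommRing R] (a : n → n → R) :
    ∑ T : Finset n, (-1 : R) ^ T.card * ∏ k, ∑ j ∈ Tᶜ, a j k =
      ∑ σ : Equiv.Perm n, ∏ k, a (σ k) k := by
  have h1 (T : Finset n) : ∏ k, ∑ j ∈ Tᶜ, a j k =
      ∑ p : n → n, if T ⊆ (Finset.univ.image p)ᶜ then ∏ k, a (p k) k else 0 := by
    rw [Finset.prod_univ_sum, ← Finset.sum_filter]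
    refine Finset.sum_congr ?_ fun _ _ => rfl
    ext p
    simp only [Fintype.mem_piFinset, Finset.mem_compl, Finset.mem_filter, Finset.mem_univ,
      true_and, Finset.subset_iff, Finset.mem_image, not_exists]
    exact ⟨fun h x hx k hk => h k (hk ▸ hx), fun h k hk => h hk k rfl⟩
  have h2 (p : n → n) : ∑ T : Finset n, (-1 : R) ^ T.card *
      (if T ⊆ (Finset.univ.image p)ᶜ then ∏ k, a (p k) k else 0) =
        if Function.Bijective p then ∏ k, a (p k) k else 0 := by
    have h3 : ∑ T ∈ (Finset.univ.image p)ᶜ.powerset, (-1 : R) ^ T.card =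
        if (Finset.univ.image p)ᶜ = ∅ then 1 else 0 := by
      have := congrArg (Int.cast : ℤ → R)
        (Finset.sum_powerset_neg_one_pow_card (x := (Finset.univ.image p)ᶜ))
      push_cast at this
      exact this
    have h4 : (Finset.univ.image p)ᶜ = ∅ ↔ Function.Bijective p := by
      rw [Finset.compl_eq_empty_iff, ← Finite.surjective_iff_bijective, Finset.eq_univ_iff_forall]
      simp [Function.Surjective]
    simp only [mul_ite, mul_zero, ← Finset.sum_filter, ← Finset.sum_mul]
    rw [show (Finset.univ.filter fun T => T ⊆ (Finset.univ.image p)ᶜ) =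
      (Finset.univ.image p)ᶜ.powerset by ext; simp, h3]
    simp only [h4, ite_mul, one_mul, zero_mul]
  simp only [h1, Finset.mul_sum]
  rw [Finset.sum_comm]
  simp only [h2, ← Finset.sum_filter]
  refine Finset.sum_bij' (fun p hp => Equiv.ofBijective p (Finset.mem_filter.1 hp).2)
    (fun σ _ => ⇑σ) ?_ ?_ ?_ ?_ ?_
  · simp
  · intro σ _
    simp
  · intros; rfl
  · intros; ext; rfl
  · intros; rfl

section SymMatExp

variable {d : ℕ}

/-- A real symmetric matrix, seen as a bounded operator on `ℂ^d`. -/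
noncomputable def symMatToCLM (d : ℕ) :
    SymMat d →L[ℝ] (EuclideanSpace ℂ (Fin d) →L[ℂ] EuclideanSpace ℂ (Fin d)) :=
  LinearMap.toContinuousLinearMap
    { toFun := fun B => toEuclideanCLM (𝕜 := ℂ) ((B : Matrix (Fin d) (Fin d) ℝ).map Complex.ofReal)
      map_add' := fun A B => by
        rw [← map_add]
        congr 1
        ext
        simp
      map_smul' := fun c A => by
        have h : ((c • A : SymMat d) : Matrix (Fin d) (Fin d) ℝ).map Complex.ofReal =
            (c : ℂ) • (A : Matrix (Fin d) (Fin d) ℝ).map Complex.ofReal := by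
          ext
          simp
        rw [h, map_smul]
        rfl }

theorem isSelfAdjoint_symMatToCLM (B : SymMat d) : IsSelfAdjoint (symMatToCLM d B) := by
  have h : star ((B : Matrix (Fin d) (Fin d) ℝ).map Complex.ofReal) =
      (B : Matrix (Fin d) (Fin d) ℝ).map Complex.ofReal := by
    ext i j
    simp [Matrix.star_apply, B.2.apply i j]
  change star (toEuclideanCLM (𝕜 := ℂ) _) = toEuclideanCLM (𝕜 := ℂ) _
  rw [← map_star, h]

/-- The unitary operator `exp (i B)` of a real symmetric matrix `B`. -/
noncomputable def symMatExp (B : SymMat d) :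
    EuclideanSpace ℂ (Fin d) →L[ℂ] EuclideanSpace ℂ (Fin d) :=
  NormedSpace.exp (Complex.I • symMatToCLM d B)

theorem contDiff_symMatExp : ContDiff ℝ (⊤ : ℕ∞) (symMatExp (d := d)) := by
  have h : ContDiff ℝ (⊤ : ℕ∞) (NormedSpace.exp :
      (EuclideanSpace ℂ (Fin d) →L[ℂ] EuclideanSpace ℂ (Fin d)) → _) :=
    contDiff_iff_contDiffAt.2 fun x => (NormedSpace.exp_analytic (𝕂 := ℝ) x).contDiffAt
  exact h.comp ((contDiff_const_smul Complex.I).comp (symMatToCLM d).contDiff)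

theorem norm_symMatExp_le (B : SymMat d) : ‖symMatExp B‖ ≤ 1 := by
  have h := (selfAdjoint.expUnitary
    ⟨symMatToCLM d B, selfAdjoint.mem_iff.2 (isSelfAdjoint_symMatToCLM B)⟩).2
  rw [selfAdjoint.expUnitary_coe] at h
  refine ContinuousLinearMap.opNorm_le_bound _ zero_le_one fun x => ?_
  rw [one_mul]
  exact (ContinuousLinearMap.norm_map_of_mem_unitary h x).le

theorem symMatExp_eq_half_mul_half (B : SymMat d) :
    symMatExp B = symMatExp ((2⁻¹ : ℝ) • B) * symMatExp ((2⁻¹ : ℝ) • B) := by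
  let : NormedAlgebra ℚ (EuclideanSpace ℂ (Fin d) →L[ℂ] EuclideanSpace ℂ (Fin d)) :=
    .restrictScalars ℚ ℂ _
  have h : Complex.I • symMatToCLM d B = Complex.I • symMatToCLM d ((2⁻¹ : ℝ) • B) +
      Complex.I • symMatToCLM d ((2⁻¹ : ℝ) • B) := by
    refine Eq.trans ?_ (smul_add _ _ _)
    rw [← map_add, ← add_smul]
    norm_num
  rw [symMatExp, h, NormedSpace.exp_add_of_commute (Commute.refl _)]
  rfl

/-- The matrix `exp (i B)` of a real symmetric matrix `B`. -/
noncomputable def symMatExpMatrix (B : SymMat d) : Matrix (Fin d) (Fin d) ℂ :=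
  (toEuclideanCLM (𝕜 := ℂ)).symm (symMatExp B)

theorem toEuclideanCLM_symMatExpMatrix (B : SymMat d) :
    toEuclideanCLM (𝕜 := ℂ) (symMatExpMatrix B) = symMatExp B :=
  StarAlgEquiv.apply_symm_apply _ _

/-- A matrix entry of an operator on `ℂ^d`. -/
noncomputable def clmEntry (i j : Fin d) :
    (EuclideanSpace ℂ (Fin d) →L[ℂ] EuclideanSpace ℂ (Fin d)) →L[ℝ] ℂ :=
  ((EuclideanSpace.proj i : EuclideanSpace ℂ (Fin d) →L[ℂ] ℂ).restrictScalars ℝ).comp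
    ((ContinuousLinearMap.apply ℂ (EuclideanSpace ℂ (Fin d))
      (EuclideanSpace.single j (1 : ℂ))).restrictScalars ℝ)

theorem clmEntry_symMatExp (B : SymMat d) (i j : Fin d) :
    clmEntry i j (symMatExp B) = symMatExpMatrix B i j := by
  rw [← toEuclideanCLM_symMatExpMatrix]
  simp [clmEntry]

theorem symMatExpMatrix_conj {g : Matrix (Fin d) (Fin d) ℝ} (hg : g * gᵀ = 1) {x y : SymMat d}
    (h : (y : Matrix (Fin d) (Fin d) ℝ) = g * (x : Matrix (Fin d) (Fin d) ℝ) * gᵀ) :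
    symMatExpMatrix y = g.map Complex.ofReal * symMatExpMatrix x * gᵀ.map Complex.ofReal := by
  let : NormedAlgebra ℚ (EuclideanSpace ℂ (Fin d) →L[ℂ] EuclideanSpace ℂ (Fin d)) :=
    .restrictScalars ℚ ℂ _
  have hmap (M N : Matrix (Fin d) (Fin d) ℝ) : (M * N).map Complex.ofReal =
      M.map Complex.ofReal * N.map Complex.ofReal := Matrix.map_mul (f := Complex.ofRealHom)
  have hone : (1 : Matrix (Fin d) (Fin d) ℝ).map Complex.ofReal = 1 :=
    Matrix.map_one _ Complex.ofReal_zero Complex.ofReal_one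
  let u : (EuclideanSpace ℂ (Fin d) →L[ℂ] EuclideanSpace ℂ (Fin d))ˣ :=
    ⟨toEuclideanCLM (𝕜 := ℂ) (g.map Complex.ofReal),
      toEuclideanCLM (𝕜 := ℂ) (gᵀ.map Complex.ofReal),
      by rw [← map_mul, ← hmap, hg, hone, map_one],
      by rw [← map_mul, ← hmap, mul_eq_one_comm.1 hg, hone, map_one]⟩
  have hy : Complex.I • symMatToCLM d y = u * (Complex.I • symMatToCLM d x) * ↑u⁻¹ := by
    rw [mul_smul_comm, smul_mul_assoc]
    congr 1
    change toEuclideanCLM (𝕜 := ℂ) _ = toEuclideanCLM (𝕜 := ℂ) _ * toEuclideanCLM (𝕜 := ℂ) _ *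
      toEuclideanCLM (𝕜 := ℂ) _
    rw [← map_mul, ← map_mul, ← hmap, ← hmap, h]
  apply EquivLike.injective (toEuclideanCLM (n := Fin d) (𝕜 := ℂ))
  rw [map_mul, map_mul, toEuclideanCLM_symMatExpMatrix, toEuclideanCLM_symMatExpMatrix, symMatExp,
    hy, NormedSpace.exp_units_conj]
  rfl

theorem symMatExpMatrix_diagonal (v : Fin d → ℝ) :
    symMatExpMatrix ⟨Matrix.diagonal v, Matrix.isSymm_diagonal v⟩ =
      Matrix.diagonal fun i => Complex.exp (v i * Complex.I) := by
  let : NormedAlgebra ℚ (Fin d → ℂ) := .restrictScalars ℚ ℂ _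
  let : Algebra ℚ (EuclideanSpace ℂ (Fin d) →L[ℂ] EuclideanSpace ℂ (Fin d)) :=
    (NormedAlgebra.restrictScalars ℚ ℂ _).toAlgebra
  let D : (Fin d → ℂ) →ₐ[ℂ] (EuclideanSpace ℂ (Fin d) →L[ℂ] EuclideanSpace ℂ (Fin d)) :=
    (toEuclideanCLM (n := Fin d) (𝕜 := ℂ)).toAlgEquiv.toAlgHom.comp (Matrix.diagonalAlgHom ℂ)
  have hD : Continuous D := LinearMap.continuous_of_finiteDimensional D.toLinearMap
  have h : Complex.I • symMatToCLM d ⟨Matrix.diagonal v, Matrix.isSymm_diagonal v⟩ =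
      D fun i => v i * Complex.I := by
    change Complex.I • toEuclideanCLM (𝕜 := ℂ) _ = toEuclideanCLM (𝕜 := ℂ) (Matrix.diagonal _)
    rw [← map_smul]
    congr 1
    ext i j
    by_cases hij : i = j
    · subst hij; simp [mul_comm]
    · simp [hij]
  apply EquivLike.injective (toEuclideanCLM (n := Fin d) (𝕜 := ℂ))
  rw [toEuclideanCLM_symMatExpMatrix, symMatExp, h, ← NormedSpace.map_exp D hD]
  change toEuclideanCLM (𝕜 := ℂ) (Matrix.diagonal _) = _
  congr 2
  ext i
  rw [Pi.coe_exp, Complex.exp_eq_exp_ℂ]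

/-- The rotation-invariant extension to symmetric matrices of the sum over all permutations of the
coordinates of the plane wave `x ↦ exp (2 π i ⟪ξ, x⟫)`. -/
noncomputable def orbitalWave (ξ : EuclideanSpace ℝ (Fin d)) (A : SymMat d) : ℂ :=
  ∑ T : Finset (Fin d), (-1 : ℂ) ^ T.card *
    (∑ j ∈ Tᶜ, symMatExpMatrix ((2 * Real.pi * ξ j) • A)).det

theorem isModerate_orbitalWave : IsModerate (orbitalWave (d := d)) := by
  refine IsModerate.sum _ fun T _ => (IsModerate.const _).mul (IsModerate.det fun a b => ?_)
  simp only [Matrix.sum_apply]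
  refine IsModerate.sum _ fun j _ => ?_
  simp only [← clmEntry_symMatExp]
  exact (IsModerate.comp_smul contDiff_symMatExp
    (exists_norm_iteratedFDeriv_le_of_eq_half_mul_half contDiff_symMatExp norm_symMatExp_le
      symMatExp_eq_half_mul_half)
    ((2 * Real.pi) • (EuclideanSpace.proj j : EuclideanSpace ℝ (Fin d) →L[ℝ] ℝ))).clm_comp
      (clmEntry a b)

theorem contDiff_uncurry_orbitalWave :
    ContDiff ℝ (⊤ : ℕ∞) (Function.uncurry (orbitalWave (d := d))) := by
  have h (a b j : Fin d) : ContDiff ℝ (⊤ : ℕ∞) fun p : EuclideanSpace ℝ (Fin d) × SymMat d =>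
      symMatExpMatrix ((2 * Real.pi * p.1 j) • p.2) a b := by
    simp only [← clmEntry_symMatExp]
    refine (clmEntry a b).contDiff.comp (contDiff_symMatExp.comp ?_)
    fun_prop
  simp only [Function.uncurry_def, orbitalWave, Matrix.det_apply', Matrix.sum_apply]
  fun_prop

theorem orbitalWave_conj {g : Matrix (Fin d) (Fin d) ℝ} (hg : g * gᵀ = 1) {x y : SymMat d}
    (h : (y : Matrix (Fin d) (Fin d) ℝ) = g * (x : Matrix (Fin d) (Fin d) ℝ) * gᵀ)
    (ξ : EuclideanSpace ℝ (Fin d)) : orbitalWave ξ y = orbitalWave ξ x := by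
  have h1 : gᵀ.map Complex.ofReal * g.map Complex.ofReal = 1 := by
    rw [← Matrix.map_one _ Complex.ofReal_zero Complex.ofReal_one, ← mul_eq_one_comm.1 hg]
    exact (Matrix.map_mul (f := Complex.ofRealHom)).symm
  refine Finset.sum_congr rfl fun T _ => ?_
  have hs (c : ℝ) : ((c • y : SymMat d) : Matrix (Fin d) (Fin d) ℝ) =
      g * ((c • x : SymMat d) : Matrix (Fin d) (Fin d) ℝ) * gᵀ := by
    simp [h]
  simp only [symMatExpMatrix_conj hg (hs _), ← Finset.sum_mul, ← Finset.mul_sum]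
  rw [Matrix.det_mul_comm, ← Matrix.mul_assoc, h1, Matrix.one_mul]

theorem orbitalWave_diagonal (ξ : EuclideanSpace ℝ (Fin d)) (v : Fin d → ℝ) :
    orbitalWave ξ ⟨Matrix.diagonal v, Matrix.isSymm_diagonal v⟩ =
      ∑ σ : Equiv.Perm (Fin d),
        Complex.exp (↑(2 * Real.pi * inner ℝ ξ (WithLp.toLp 2 (v ∘ σ))) * Complex.I) := by
  have hd (c : ℝ) : c • (⟨Matrix.diagonal v, Matrix.isSymm_diagonal v⟩ : SymMat d) =
      ⟨Matrix.diagonal (c • v), Matrix.isSymm_diagonal _⟩ :=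
    Subtype.ext (Matrix.diagonal_smul c v).symm
  have hsum (T : Finset (Fin d)) (w : Fin d → Fin d → ℂ) :
      ∑ j ∈ Tᶜ, Matrix.diagonal (w j) = Matrix.diagonal fun k => ∑ j ∈ Tᶜ, w j k := by
    ext a b
    by_cases hab : a = b
    · subst hab; simp [Matrix.sum_apply]
    · simp [Matrix.sum_apply, hab]
  simp only [orbitalWave, hd, symMatExpMatrix_diagonal, hsum, Matrix.det_diagonal]
  rw [sum_neg_one_pow_card_mul_prod_sum_compl, ← Equiv.sum_comp (Equiv.inv _)]
  refine Finset.sum_congr rfl fun σ _ => ?_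
  rw [← Complex.exp_sum, ← Finset.sum_mul, PiLp.inner_apply, ← Complex.ofReal_sum, Finset.mul_sum]
  congr 3
  rw [← Equiv.sum_comp σ]
  refine Finset.sum_congr rfl fun k _ => ?_
  simp
  ring

end SymMatExp

/-- The Frobenius norm of a real matrix is invariant under orthogonal conjugation. -/
theorem frobenius_norm_orthogonal_conj {d : ℕ} {g : Matrix (Fin d) (Fin d) ℝ} (hg : gᵀ * g = 1)
    (M : Matrix (Fin d) (Fin d) ℝ) : ‖g * M * gᵀ‖ = ‖M‖ := by
  have h (N : Matrix (Fin d) (Fin d) ℝ) : ‖N‖ = (N * Nᵀ).trace ^ (1 / 2 : ℝ) := by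
    rw [Matrix.frobenius_norm_def]
    simp [Matrix.trace, Matrix.mul_apply, sq]
  rw [h, h, Matrix.transpose_mul, Matrix.transpose_mul, Matrix.transpose_transpose]
  congr 1
  calc _ = (g * (M * (gᵀ * g) * Mᵀ * gᵀ)).trace := by simp only [Matrix.mul_assoc]
    _ = _ := by rw [hg, Matrix.mul_one, Matrix.trace_mul_comm, Matrix.mul_assoc, hg, Matrix.mul_one]

/-- Every real symmetric matrix is orthogonally conjugate to a diagonal one. -/
theorem SymMat.exists_eq_orthogonal_conj_diagonal {d : ℕ} (A : SymMat d) :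
    ∃ (g : Matrix (Fin d) (Fin d) ℝ) (v : Fin d → ℝ), g * gᵀ = 1 ∧ gᵀ * g = 1 ∧
      (A : Matrix (Fin d) (Fin d) ℝ) = g * Matrix.diagonal v * gᵀ := by
  have hA : (A : Matrix (Fin d) (Fin d) ℝ).IsHermitian := by
    rw [Matrix.IsHermitian, Matrix.conjTranspose_eq_transpose_of_trivial]
    exact A.2
  have h1 := Unitary.mul_star_self_of_mem hA.eigenvectorUnitary.2
  have h2 := Unitary.star_mul_self_of_mem hA.eigenvectorUnitary.2
  have h3 := hA.spectral_theorem
  rw [Unitary.conjStarAlgAut_apply] at h3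
  rw [Matrix.star_eq_conjTranspose, Matrix.conjTranspose_eq_transpose_of_trivial] at h1 h2 h3
  exact ⟨_, _, h1, h2, h3⟩

theorem apply_diagonal_comp_perm {d : ℕ} {F : SymMat d → ℝ}
    (hinv : ∀ g : Matrix (Fin d) (Fin d) ℝ, g * gᵀ = 1 →
      ∀ x y : SymMat d, (y : Matrix (Fin d) (Fin d) ℝ) = g * (x : Matrix (Fin d) (Fin d) ℝ) * gᵀ →
        F y = F x) (v : Fin d → ℝ) (σ : Equiv.Perm (Fin d)) :
    F ⟨Matrix.diagonal (v ∘ σ), Matrix.isSymm_diagonal _⟩ =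
      F ⟨Matrix.diagonal v, Matrix.isSymm_diagonal _⟩ := by
  refine hinv ((1 : Matrix (Fin d) (Fin d) ℝ).submatrix σ id) ?_ _ _ ?_
  · ext i j
    simp [Matrix.mul_apply, Matrix.one_apply]
  · ext i j
    by_cases h : i = j <;> simp [Matrix.mul_apply, Matrix.one_apply, Matrix.diagonal_apply, h]

open FourierTransform in
/-- The sum over all permutations of the coordinates of a Schwartz function extends smoothly from
the diagonal matrices to a rotation-invariant function on the symmetric matrices. -/
theorem SchwartzMap.exists_contDiff_rotation_invariant_extension {d : ℕ}
    (φ : SchwartzMap (EuclideanSpace ℝ (Fin d)) ℂ) :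
    ∃ H : SymMat d → ℂ, ContDiff ℝ (⊤ : ℕ∞) H ∧
      (∀ g : Matrix (Fin d) (Fin d) ℝ, g * gᵀ = 1 → ∀ x y : SymMat d,
        (y : Matrix (Fin d) (Fin d) ℝ) = g * (x : Matrix (Fin d) (Fin d) ℝ) * gᵀ → H y = H x) ∧
      ∀ v : Fin d → ℝ, H ⟨Matrix.diagonal v, Matrix.isSymm_diagonal v⟩ =
        ∑ σ : Equiv.Perm (Fin d), φ (WithLp.toLp 2 (v ∘ σ)) := by
  have hfourier (w : EuclideanSpace ℝ (Fin d)) :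
      ∫ ξ, 𝓕 φ ξ * Complex.exp (↑(2 * Real.pi * inner ℝ ξ w) * Complex.I) = φ w := by
    have h1 : 𝓕⁻ (𝓕 φ) w = φ w := by rw [FourierTransform.fourierInv_fourier_eq]
    rw [← h1, SchwartzMap.fourierInv_coe, Real.fourierInv_eq']
    simp only [smul_eq_mul, mul_comm]
  refine ⟨fun A => ∫ ξ, 𝓕 φ ξ * orbitalWave ξ A,
    isModerate_orbitalWave.contDiff_integral_mul _ contDiff_uncurry_orbitalWave _,
    fun g hg x y h => by simp only [orbitalWave_conj hg h], fun v => ?_⟩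
  simp only [orbitalWave_diagonal, Finset.mul_sum]
  rw [MeasureTheory.integral_finsetSum]
  · simp only [hfourier]
  · intro σ _
    refine (SchwartzMap.integrable (𝓕 φ)).mul_bdd (c := 1) ?_ ?_
    · exact Continuous.aestronglyMeasurable (by fun_prop)
    · exact .of_forall fun ξ => (Complex.norm_exp_ofReal_mul_I _).le

/-- A rotation-invariant function on the real symmetric matrices whose restriction to the
diagonal matrices is `C^∞` is itself `C^∞`. -/
theorem rotation_invariant_smooth_of_diagonal_restriction
    (d : ℕ) (F : SymMat d → ℝ)
    (hinv : ∀ g : Matrix (Fin d) (Fin d) ℝ, g * gᵀ = 1 →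
      ∀ x y : SymMat d, (y : Matrix (Fin d) (Fin d) ℝ) = g * (x : Matrix (Fin d) (Fin d) ℝ) * gᵀ →
        F y = F x)
    (hdiag : ContDiff ℝ (⊤ : ℕ∞) fun r : EuclideanSpace ℝ (Fin d) =>
      F ⟨Matrix.diagonal (fun i => r i), Matrix.isSymm_diagonal _⟩) :
    ContDiff ℝ (⊤ : ℕ∞) F := by
  refine contDiff_iff_contDiffAt.2 fun A₀ => ?_
  let χ : ContDiffBump (0 : EuclideanSpace ℝ (Fin d)) :=
    ⟨‖A₀‖ + 1, ‖A₀‖ + 2, by positivity, by linarith⟩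
  let f : EuclideanSpace ℝ (Fin d) → ℂ := fun r =>
    ((χ r * F ⟨Matrix.diagonal (fun i => r i), Matrix.isSymm_diagonal _⟩ : ℝ) : ℂ)
  have hf : ContDiff ℝ (⊤ : ℕ∞) f := Complex.ofRealCLM.contDiff.comp (χ.contDiff.mul hdiag)
  have hfc : HasCompactSupport f := by
    have : HasCompactSupport fun r : EuclideanSpace ℝ (Fin d) =>
        χ r * F ⟨Matrix.diagonal (fun i => r i), Matrix.isSymm_diagonal _⟩ :=
      χ.hasCompactSupport.mul_right
    exact this.comp_left Complex.ofReal_zero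
  let φ := hfc.toSchwartzMap hf
  obtain ⟨H, hH, hHinv, hHdiag⟩ := φ.exists_contDiff_rotation_invariant_extension
  have hHF (A : SymMat d) (hA : ‖A‖ ≤ ‖A₀‖ + 1) : H A = (d.factorial : ℂ) * F A := by
    obtain ⟨g, v, hg, hg', hgA⟩ := SymMat.exists_eq_orthogonal_conj_diagonal A
    have hv : ‖(WithLp.toLp 2 v : EuclideanSpace ℝ (Fin d))‖ ≤ ‖A₀‖ + 1 := by
      rw [← Matrix.frobenius_norm_diagonal, ← frobenius_norm_orthogonal_conj hg', ← hgA]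
      exact hA
    have hφσ (σ : Equiv.Perm (Fin d)) : φ (WithLp.toLp 2 (v ∘ σ)) = F A := by
      have hχ : χ (WithLp.toLp 2 (v ∘ σ)) = 1 := by
        refine χ.one_of_mem_closedBall ?_
        rw [mem_closedBall_zero_iff]
        refine le_of_eq_of_le ?_ hv
        simp only [EuclideanSpace.norm_eq, Function.comp_apply]
        rw [Equiv.sum_comp σ fun i => ‖v i‖ ^ 2]
      change f _ = _
      simp only [f, hχ, one_mul]
      congr 1
      rw [hinv g hg ⟨Matrix.diagonal v, Matrix.isSymm_diagonal _⟩ A hgA]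
      exact apply_diagonal_comp_perm hinv v σ
    rw [hHinv g hg ⟨Matrix.diagonal v, Matrix.isSymm_diagonal v⟩ A hgA, hHdiag]
    simp only [hφσ]
    simp [Fintype.card_perm]
  have hd : (d.factorial : ℂ) ≠ 0 := Nat.cast_ne_zero.2 d.factorial_ne_zero
  have hre : ContDiff ℝ (⊤ : ℕ∞) fun A => ((d.factorial : ℂ)⁻¹ * H A).re :=
    Complex.reCLM.contDiff.comp (contDiff_const.mul hH)
  refine hre.contDiffAt.congr_of_eventuallyEq ?_
  filter_upwards [Metric.ball_mem_nhds A₀ one_pos] with A hA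
  rw [hHF A, inv_mul_cancel_left₀ hd, Complex.ofReal_re]
  have := norm_sub_norm_le A A₀
  rw [Metric.mem_ball, dist_eq_norm] at hA
  linarith
end

section
/- Let F be a rotation-invariant function on the space of real d×d symmetric matrices. If the restriction of F to the diagonal matrices is real-analytic, then F is real-analytic. -/
open Matrix

attribute [local instance] Matrix.frobeniusNormedAddCommGroup Matrix.frobeniusNormedSpace

section RotationInvariant

open Filter Topology Finset

attribute [local instance] Matrix.frobeniusNormedRing Matrix.frobeniusNormedAlgebra

section FunctionalCalculus

variable {ι A : Type*} [Fintype ι] [NormedRing A] [NormedAlgebra ℝ A]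

/-- The power series in noncommuting variables obtained by substituting elements of a Banach
algebra for the coordinates in a power series on `ι → ℝ`. -/
noncomputable def algebraSeries [DecidableEq ι] (A : Type*) [NormedRing A] [NormedAlgebra ℝ A]
    (p : FormalMultilinearSeries ℝ (ι → ℝ) ℝ) : FormalMultilinearSeries ℝ (ι → A) A :=
  fun n => ∑ s : Fin n → ι, p n (fun k => Pi.single (s k) 1) •
    (ContinuousMultilinearMap.mkPiAlgebraFin ℝ n A).compContinuousLinearMap
      (fun k => ContinuousLinearMap.proj (R := ℝ) (φ := fun _ : ι => A) (s k))

lemma norm_algebraSeries_le [DecidableEq ι] (p : FormalMultilinearSeries ℝ (ι → ℝ) ℝ) (n : ℕ) :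
    ‖algebraSeries A p n‖ ≤ (Fintype.card ι : ℝ) ^ n * (‖p n‖ * max 1 ‖(1 : A)‖) := by
  refine ContinuousMultilinearMap.opNorm_le_bound (by positivity) fun m => ?_
  have h : ∀ s ∈ (univ : Finset (Fin n → ι)), ‖p n (fun k => Pi.single (s k) 1) •
      (List.ofFn fun k => m k (s k)).prod‖ ≤ ‖p n‖ * max 1 ‖(1 : A)‖ * ∏ k, ‖m k‖ := by
    intro s _
    rw [norm_smul, mul_assoc]
    refine mul_le_mul ?_ ?_ (norm_nonneg _) (norm_nonneg _)
    · refine ((p n).le_opNorm _).trans ?_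
      simp [Pi.norm_single]
    · rw [← ContinuousMultilinearMap.mkPiAlgebraFin_apply (R := ℝ)]
      refine ((ContinuousMultilinearMap.mkPiAlgebraFin ℝ n A).le_opNorm _).trans ?_
      gcongr with k
      · exact ContinuousMultilinearMap.norm_mkPiAlgebraFin_le
      · exact norm_le_pi_norm (m k) (s k)
  have hm : algebraSeries A p n m = ∑ s : Fin n → ι, p n (fun k => Pi.single (s k) 1) •
      (List.ofFn fun k => m k (s k)).prod := by
    simp [algebraSeries]
  rw [hm]
  refine (norm_sum_le_of_le _ h).trans (le_of_eq ?_)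
  simp [mul_assoc]

lemma algebraSeries_radius_pos [DecidableEq ι] {p : FormalMultilinearSeries ℝ (ι → ℝ) ℝ}
    (hp : 0 < p.radius) : 0 < (algebraSeries A p).radius := by
  obtain ⟨r, hr0, hr⟩ := ENNReal.lt_iff_exists_nnreal_btwn.1 hp
  obtain ⟨C, hC0, hC⟩ := p.norm_mul_pow_le_of_lt_radius hr
  have hr0' : 0 < r := by exact_mod_cast hr0
  have hpos : (0 : NNReal) < r / (Fintype.card ι + 1) := by positivity
  refine lt_of_lt_of_le (by exact_mod_cast hpos)
    ((algebraSeries A p).le_radius_of_bound (C * max 1 ‖(1 : A)‖)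
      (r := r / (Fintype.card ι + 1)) fun n => ?_)
  have h1 : ((Fintype.card ι : ℝ) / (Fintype.card ι + 1)) ^ n ≤ 1 :=
    pow_le_one₀ (by positivity) (div_le_one_of_le₀ (by linarith) (by positivity))
  calc ‖algebraSeries A p n‖ * ((r / (Fintype.card ι + 1) : NNReal) : ℝ) ^ n
      ≤ (Fintype.card ι : ℝ) ^ n * (‖p n‖ * max 1 ‖(1 : A)‖) *
          ((r / (Fintype.card ι + 1) : NNReal) : ℝ) ^ n := by
        gcongr
        exact norm_algebraSeries_le p n
    _ = ((Fintype.card ι : ℝ) / (Fintype.card ι + 1)) ^ n * (‖p n‖ * (r : ℝ) ^ n) *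
          max 1 ‖(1 : A)‖ := by
        push_cast
        rw [div_pow, div_pow]
        ring
    _ ≤ 1 * C * max 1 ‖(1 : A)‖ := by
        gcongr
        exact hC n
    _ = C * max 1 ‖(1 : A)‖ := by ring

lemma prod_ofFn_mul_eq_smul {n : ℕ} (b : Fin n → A) (v : Fin n → ℝ) (e : A)
    (h : ∀ k, b k * e = v k • e) : (List.ofFn b).prod * e = (∏ k, v k) • e := by
  induction n with
  | zero => simp
  | succ n ih =>
    rw [List.ofFn_succ, List.prod_cons, mul_assoc, ih _ (fun k => v k.succ) fun k => h k.succ,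
      mul_smul_comm, h, smul_smul, Fin.prod_univ_succ, mul_comm]

lemma algebraSeries_apply_mul [DecidableEq ι] (p : FormalMultilinearSeries ℝ (ι → ℝ) ℝ) (n : ℕ)
    (b : ι → A) (v : ι → ℝ) (e : A) (h : ∀ i, b i * e = v i • e) :
    algebraSeries A p n (fun _ => b) * e = p n (fun _ => v) • e := by
  have hv : v = ∑ i, v i • (Pi.single i 1 : ι → ℝ) := by
    simpa using (pi_eq_sum_univ' v)
  have hp : p n (fun _ => v)
      = ∑ s : Fin n → ι, (∏ k, v (s k)) * p n (fun k => Pi.single (s k) 1) := by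
    conv_lhs => rw [hv]
    rw [ContinuousMultilinearMap.map_sum]
    refine sum_congr rfl fun s _ => ?_
    rw [ContinuousMultilinearMap.map_smul_univ, smul_eq_mul]
  rw [hp, sum_smul, algebraSeries, _root_.sum_apply, sum_mul]
  refine sum_congr rfl fun s _ => ?_
  rw [_root_.smul_apply, smul_mul_assoc,
    ContinuousMultilinearMap.compContinuousLinearMap_apply,
    ContinuousMultilinearMap.mkPiAlgebraFin_apply]
  simp only [ContinuousLinearMap.proj_apply]
  rw [prod_ofFn_mul_eq_smul _ (fun k => v (s k)) e fun k => h (s k), smul_smul, mul_comm]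

lemma abs_le_norm_of_mul_eq_smul {b e : A} {a : ℝ} (he : e ≠ 0) (h : b * e = a • e) :
    |a| ≤ ‖b‖ := by
  have := norm_mul_le b e
  rw [h, norm_smul, Real.norm_eq_abs] at this
  exact le_of_mul_le_mul_right this (norm_pos_iff.2 he)

/-- An analytic germ at `0` can be evaluated analytically at small tuples in a Banach algebra,
compatibly with simultaneous eigenvectors. -/
theorem exists_analytic_calculus [CompleteSpace A] {f : (ι → ℝ) → ℝ} (hf : AnalyticAt ℝ f 0) :
    ∃ Ψ : (ι → A) → A, AnalyticAt ℝ Ψ 0 ∧ ∀ᶠ b in 𝓝 (0 : ι → A), ∀ (v : ι → ℝ) (e : A),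
      (∀ i, b i * e = v i • e) → Ψ b * e = f v • e := by
  classical
  obtain ⟨p, r, hp⟩ := hf
  have hq : 0 < (algebraSeries A p).radius :=
    algebraSeries_radius_pos (hp.r_pos.trans_le hp.r_le)
  have hΨ := (algebraSeries A p).hasFPowerSeriesOnBall hq
  refine ⟨(algebraSeries A p).sum, hΨ.analyticAt, ?_⟩
  filter_upwards [Metric.eball_mem_nhds (0 : ι → A) hq,
    Metric.eball_mem_nhds (0 : ι → A) hp.r_pos] with b hb hb' v e h
  by_cases he : e = 0
  · simp [he]
  have hle : ‖v‖₊ ≤ ‖b‖₊ := by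
    rw [← NNReal.coe_le_coe, coe_nnnorm, coe_nnnorm]
    exact (pi_norm_le_iff_of_nonneg (norm_nonneg _)).2 fun i =>
      (abs_le_norm_of_mul_eq_smul he (h i)).trans (norm_le_pi_norm b i)
  have hv : v ∈ Metric.eball (0 : ι → ℝ) r := by
    rw [Metric.mem_eball, edist_zero_right] at hb' ⊢
    exact lt_of_le_of_lt (by simpa [enorm_eq_nnnorm] using hle) hb'
  have h1 := (hΨ.hasSum hb).mul_right e
  have h2 := (hp.hasSum hv).smul_const e
  simp only [zero_add, algebraSeries_apply_mul p _ b v e h] at h1 h2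
  exact h1.unique h2

end FunctionalCalculus

section ConjDiagonal

variable {n ι : Type*} [Fintype n] [DecidableEq n] [Fintype ι]

/-- The algebra homomorphism sending `a` to `g * diagonal a * gᵀ`, for `g` orthogonal. -/
def conjDiagonal (g : Matrix n n ℝ) (hg : gᵀ * g = 1) : (n → ℝ) →ₐ[ℝ] Matrix n n ℝ :=
  AlgHom.ofLinearMap
    { toFun := fun a => g * diagonal a * gᵀ
      map_add' := fun a b => by
        rw [← Matrix.add_mul, ← Matrix.mul_add, diagonal_add]; rfl
      map_smul' := fun r a => by
        rw [diagonal_smul]; simp }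
    (by
      change g * diagonal 1 * gᵀ = 1
      rw [show diagonal (1 : n → ℝ) = 1 from diagonal_one, Matrix.mul_one, mul_eq_one_comm.1 hg])
    (fun a b => by
      change g * diagonal (a * b) * gᵀ = (g * diagonal a * gᵀ) * (g * diagonal b * gᵀ)
      calc g * diagonal (a * b) * gᵀ = g * diagonal a * 1 * diagonal b * gᵀ := by
            simp [Matrix.mul_assoc, diagonal_mul_diagonal]; rfl
        _ = _ := by rw [← hg]; simp only [Matrix.mul_assoc])

lemma conjDiagonal_apply (g : Matrix n n ℝ) (hg : gᵀ * g = 1) (a : n → ℝ) :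
    conjDiagonal g hg a = g * diagonal a * gᵀ := rfl

lemma conjDiagonal_apply_apply (g : Matrix n n ℝ) (hg : gᵀ * g = 1) (a : n → ℝ) (i j : n) :
    conjDiagonal g hg a i j = ∑ k, g i k * a k * g j k := by
  simp [conjDiagonal_apply, Matrix.mul_apply, diagonal_apply]

lemma conjDiagonal_single_ne_zero (g : Matrix n n ℝ) (hg : gᵀ * g = 1) (k : n) :
    conjDiagonal g hg (Pi.single k 1) ≠ 0 := by
  intro h
  have h1 : gᵀ * (g * diagonal (Pi.single k (1 : ℝ)) * gᵀ) * g = diagonal (Pi.single k 1) := by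
    calc _ = (gᵀ * g) * diagonal (Pi.single k (1 : ℝ)) * (gᵀ * g) := by
          simp only [Matrix.mul_assoc]
      _ = _ := by simp [hg]
  rw [← conjDiagonal_apply g hg, h] at h1
  simpa using congrFun (congrFun h1 k) k

lemma conjDiagonal_mul_single (g : Matrix n n ℝ) (hg : gᵀ * g = 1) (a : n → ℝ) (k : n) :
    conjDiagonal g hg a * conjDiagonal g hg (Pi.single k 1)
      = a k • conjDiagonal g hg (Pi.single k 1) := by
  rw [← map_mul, ← map_smul]
  congr 1
  ext j
  by_cases h : j = k
  · subst h; simp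
  · simp [h]

lemma abs_le_norm_conjDiagonal (g : Matrix n n ℝ) (hg : gᵀ * g = 1) (a : n → ℝ) (k : n) :
    |a k| ≤ ‖conjDiagonal g hg a‖ :=
  abs_le_norm_of_mul_eq_smul (conjDiagonal_single_ne_zero g hg k) (conjDiagonal_mul_single g hg a k)

/-- An analytic germ at `0` can be evaluated analytically at small tuples of matrices, and acts
entrywise on simultaneously orthogonally diagonalized ones. -/
theorem exists_analytic_matrix_calculus {f : (ι → ℝ) → ℝ} (hf : AnalyticAt ℝ f 0) :
    ∃ Ψ : (ι → Matrix n n ℝ) → Matrix n n ℝ, AnalyticAt ℝ Ψ 0 ∧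
      ∀ᶠ b in 𝓝 (0 : ι → Matrix n n ℝ), ∀ g hg (a : ι → n → ℝ),
        (∀ i, b i = conjDiagonal g hg (a i)) →
          Ψ b = conjDiagonal g hg (fun k => f (fun i => a i k)) := by
  obtain ⟨Ψ, hΨ, h⟩ := exists_analytic_calculus (A := Matrix n n ℝ) hf
  refine ⟨Ψ, hΨ, h.mono fun b hb g hg a hba => ?_⟩
  have h1 : ∑ k, conjDiagonal g hg (Pi.single k 1) = 1 := by
    rw [← map_sum, ← map_one (conjDiagonal g hg)]
    congr 1
    ext j
    simp
  rw [← mul_one (Ψ b), ← mul_one (conjDiagonal g hg _), ← h1, mul_sum, mul_sum]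
  refine sum_congr rfl fun k _ => ?_
  rw [conjDiagonal_mul_single]
  exact hb _ _ fun i => by rw [hba, conjDiagonal_mul_single]

lemma aeval_conjDiagonal (g : Matrix n n ℝ) (hg : gᵀ * g = 1) (a : n → ℝ) (p : Polynomial ℝ) :
    Polynomial.aeval (conjDiagonal g hg a) p = conjDiagonal g hg (fun k => p.eval (a k)) := by
  have h : Polynomial.aeval a p = fun k => p.eval (a k) := by
    ext k
    simp
  rw [Polynomial.aeval_algHom_apply, h]

lemma half_add_div_sqrt_eq_zero_or_one {t : ℝ} (ht : |t ^ 2 - t| < 1 / 4) :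
    1 / 2 + (t - 1 / 2) * (√(1 + 4 * (t ^ 2 - t)))⁻¹ = 0 ∨
      1 / 2 + (t - 1 / 2) * (√(1 + 4 * (t ^ 2 - t)))⁻¹ = 1 := by
  have h1 : 1 + 4 * (t ^ 2 - t) = (2 * (t - 1 / 2)) ^ 2 := by ring
  have h2 : t - 1 / 2 ≠ 0 := by
    intro h
    have : t = 1 / 2 := by linarith
    rw [this] at ht
    norm_num [abs_of_nonneg] at ht
  rw [h1, Real.sqrt_sq_eq_abs]
  rcases lt_or_gt_of_ne h2 with h | h
  · left
    rw [abs_of_neg (by linarith), inv_neg, mul_inv, mul_neg, mul_comm (2⁻¹ : ℝ),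
      mul_inv_cancel_left₀ h2]
    norm_num
  · right
    rw [abs_of_pos (by linarith), mul_inv, mul_comm (2⁻¹ : ℝ), mul_inv_cancel_left₀ h2]
    norm_num

/-- The spectral projection onto the eigenvalues close to `c i` depends analytically on the matrix
near `conjDiagonal g₀ hg₀ c`. -/
theorem exists_analytic_spectral_projection (g₀ : Matrix n n ℝ) (hg₀ : g₀ᵀ * g₀ = 1) (c : n → ℝ)
    (i : n) : ∃ (P : Matrix n n ℝ → Matrix n n ℝ) (W : ℝ → ℝ),
      AnalyticAt ℝ P (conjDiagonal g₀ hg₀ c) ∧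
      (∀ k, W (c k) = if c k = c i then 1 else 0) ∧
      ∀ᶠ x in 𝓝 (conjDiagonal g₀ hg₀ c), ∀ g hg a, x = conjDiagonal g hg a →
        P x = conjDiagonal g hg (fun k => W (a k)) ∧ ∀ k, W (a k) = 0 ∨ W (a k) = 1 := by
  let φ : Polynomial ℝ := ∏ k with c k ≠ c i,
    Polynomial.C (c i - c k)⁻¹ * (Polynomial.X - Polynomial.C (c k))
  have hφ : ∀ k, φ.eval (c k) = if c k = c i then 1 else 0 := by
    intro k
    split_ifs with h
    · rw [Polynomial.eval_prod]
      refine prod_eq_one fun j hj => ?_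
      have : c i - c j ≠ 0 := sub_ne_zero.2 (Ne.symm (mem_filter.1 hj).2)
      simp [h, this]
    · rw [Polynomial.eval_prod]
      exact prod_eq_zero (mem_filter.2 ⟨mem_univ k, h⟩) (by simp)
  have hf : AnalyticAt ℝ (fun v : Unit → ℝ => (√(1 + 4 * v ()))⁻¹) 0 := by
    have h1 : AnalyticAt ℝ (fun v : Unit → ℝ => v ()) 0 :=
      (ContinuousLinearMap.proj (R := ℝ) (φ := fun _ : Unit => ℝ) ()).analyticAt _
    have h2 : AnalyticAt ℝ (fun v : Unit → ℝ => 1 + 4 * v ()) 0 :=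
      analyticAt_const.add (analyticAt_const.mul h1)
    have h3 : AnalyticAt ℝ Real.sqrt (1 + 4 * (0 : Unit → ℝ) ()) :=
      (Real.contDiffAt_sqrt (by simp)).analyticAt
    exact (h3.comp h2 (x := 0)).inv (by simp)
  obtain ⟨Ψ, hΨ, h⟩ := exists_analytic_matrix_calculus (n := n) hf
  let E : Matrix n n ℝ → Matrix n n ℝ := fun x => Polynomial.aeval x φ
  let Y : Matrix n n ℝ → Unit → Matrix n n ℝ := fun x _ => E x ^ 2 - E x
  have hE : ∀ g hg a, E (conjDiagonal g hg a) = conjDiagonal g hg (fun k => φ.eval (a k)) :=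
    fun g hg a => aeval_conjDiagonal g hg a φ
  have hY : ∀ g hg a u, Y (conjDiagonal g hg a) u
      = conjDiagonal g hg (fun k => φ.eval (a k) ^ 2 - φ.eval (a k)) := by
    intro g hg a u
    simp only [Y]
    rw [hE, ← map_pow, ← map_sub]
    rfl
  have hEa : AnalyticAt ℝ E (conjDiagonal g₀ hg₀ c) := analyticAt_id.aeval_polynomial φ
  have hYa : AnalyticAt ℝ Y (conjDiagonal g₀ hg₀ c) :=
    AnalyticAt.pi fun _ => (hEa.pow 2).sub hEa
  have hY0 : Y (conjDiagonal g₀ hg₀ c) = 0 := by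
    ext1 u
    rw [hY _ _ _ u, Pi.zero_apply, ← map_zero (conjDiagonal g₀ hg₀)]
    congr 1
    ext k
    rw [hφ]
    split_ifs <;> simp
  have hYt : Tendsto Y (𝓝 (conjDiagonal g₀ hg₀ c)) (𝓝 0) := hY0 ▸ hYa.continuousAt.tendsto
  refine ⟨fun x => (1 / 2 : ℝ) • 1 + (E x - (1 / 2 : ℝ) • 1) * Ψ (Y x),
    fun t => 1 / 2 + (φ.eval t - 1 / 2) * (√(1 + 4 * (φ.eval t ^ 2 - φ.eval t)))⁻¹, ?_, ?_, ?_⟩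
  · exact analyticAt_const.add ((hEa.sub analyticAt_const).mul
      (AnalyticAt.comp (g := Ψ) (by rwa [hY0]) hYa))
  · intro k
    simp only [hφ]
    split_ifs <;> norm_num
  · have hsmall : ∀ᶠ b in 𝓝 (0 : Unit → Matrix n n ℝ), ‖b ()‖ < 1 / 4 := by
      have : Tendsto (fun b : Unit → Matrix n n ℝ => ‖b ()‖) (𝓝 0) (𝓝 ‖(0 : Matrix n n ℝ)‖) :=
        ((continuous_apply ()).norm).tendsto 0
      rw [norm_zero] at this
      exact this.eventually_lt_const (by norm_num)
    filter_upwards [hYt.eventually h, hYt.eventually hsmall] with x hx hx' g hg a hxa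
    subst hxa
    constructor
    · rw [hx g hg (fun _ k => φ.eval (a k) ^ 2 - φ.eval (a k)) (hY g hg a), hE,
        ← map_one (conjDiagonal g hg), ← map_smul, ← map_sub, ← map_mul, ← map_add]
      congr 1
      ext k
      simp
    · intro k
      refine half_add_div_sqrt_eq_zero_or_one (lt_of_le_of_lt ?_ hx')
      rw [hY _ _ _ ()]
      exact abs_le_norm_conjDiagonal g hg (fun k => φ.eval (a k) ^ 2 - φ.eval (a k)) k

lemma IsSymm.exists_eq_conjDiagonal {A : Matrix n n ℝ} (hA : A.IsSymm) :
    ∃ g hg a, A = conjDiagonal g hg a := by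
  have hA' : A.IsHermitian := by
    rw [Matrix.IsHermitian, conjTranspose_eq_transpose_of_trivial]; exact hA
  refine ⟨(hA'.eigenvectorUnitary : Matrix n n ℝ), ?_, hA'.eigenvalues, ?_⟩
  · rw [← conjTranspose_eq_transpose_of_trivial, ← star_eq_conjTranspose]
    exact Unitary.coe_star_mul_self _
  · rw [conjDiagonal_apply, ← conjTranspose_eq_transpose_of_trivial, ← star_eq_conjTranspose]
    exact hA'.spectral_theorem

end ConjDiagonal

section Tensor

variable {n ι : Type*} [Fintype ι]

/-- The tensor product of a family of matrices, indexed by multi-indices. -/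
def tensorMatrix (M : ι → Matrix n n ℝ) : Matrix (ι → n) (ι → n) ℝ :=
  Matrix.of fun σ τ => ∏ j, M j (σ j) (τ j)

lemma tensorMatrix_apply (M : ι → Matrix n n ℝ) (σ τ : ι → n) :
    tensorMatrix M σ τ = ∏ j, M j (σ j) (τ j) := rfl

lemma tensorMatrix_transpose (M : ι → Matrix n n ℝ) :
    (tensorMatrix M)ᵀ = tensorMatrix (fun j => (M j)ᵀ) := rfl

lemma tensorMatrix_mul [Fintype n] [DecidableEq ι] (M N : ι → Matrix n n ℝ) :
    tensorMatrix M * tensorMatrix N = tensorMatrix (fun j => M j * N j) := by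
  ext σ τ
  simp only [Matrix.mul_apply, tensorMatrix_apply, prod_univ_sum, Fintype.piFinset_univ,
    prod_mul_distrib]

lemma tensorMatrix_diagonal [DecidableEq n] (a : ι → n → ℝ) :
    tensorMatrix (fun j => diagonal (a j)) = diagonal (fun τ => ∏ j, a j (τ j)) := by
  ext σ τ
  rw [tensorMatrix_apply]
  by_cases h : σ = τ
  · subst h; simp
  · obtain ⟨j, hj⟩ := Function.ne_iff.1 h
    rw [diagonal_apply_ne _ h]
    exact prod_eq_zero (mem_univ j) (diagonal_apply_ne _ hj)

variable [Fintype n] [DecidableEq n] [DecidableEq ι]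

lemma tensorMatrix_orthogonal {g : Matrix n n ℝ} (hg : gᵀ * g = 1) :
    (tensorMatrix (fun _ : ι => g))ᵀ * tensorMatrix (fun _ : ι => g) = 1 := by
  rw [tensorMatrix_transpose, tensorMatrix_mul, hg, ← diagonal_one, tensorMatrix_diagonal]
  simp

lemma tensorMatrix_conjDiagonal (g : Matrix n n ℝ) (hg : gᵀ * g = 1) (a : ι → n → ℝ) :
    tensorMatrix (fun j => conjDiagonal g hg (a j))
      = conjDiagonal (tensorMatrix fun _ : ι => g) (tensorMatrix_orthogonal hg)
          (fun τ => ∏ j, a j (τ j)) := by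
  simp only [conjDiagonal_apply, tensorMatrix_transpose, ← tensorMatrix_diagonal, tensorMatrix_mul]

lemma tensorMatrix_update_conjDiagonal (g : Matrix n n ℝ) (hg : gᵀ * g = 1) (a : n → ℝ) (i : ι) :
    tensorMatrix (Function.update (1 : ι → Matrix n n ℝ) i (conjDiagonal g hg a))
      = conjDiagonal (tensorMatrix fun _ : ι => g) (tensorMatrix_orthogonal hg)
          (fun τ => a (τ i)) := by
  have h : Function.update (1 : ι → Matrix n n ℝ) i (conjDiagonal g hg a)
      = fun j => conjDiagonal g hg (Function.update (1 : ι → n → ℝ) i a j) := by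
    ext1 j
    by_cases hj : j = i
    · subst hj; simp
    · simp [hj]
  rw [h, tensorMatrix_conjDiagonal]
  congr 1
  ext τ
  rw [prod_eq_single i (fun j _ hj => by simp [hj]) (by simp)]
  simp

/-- The quadratic form of a matrix acting on `n`-fold tensors, evaluated at the totally
antisymmetric tensor. -/
def antisymmForm : Matrix (n → n) (n → n) ℝ →ₗ[ℝ] ℝ where
  toFun A := ∑ σ : Equiv.Perm n, ∑ τ : Equiv.Perm n,
    ((Equiv.Perm.sign σ : ℤ) : ℝ) * ((Equiv.Perm.sign τ : ℤ) : ℝ) * A σ τ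
  map_add' A B := by simp [mul_add, sum_add_distrib]
  map_smul' r A := by
    simp only [Matrix.smul_apply, smul_eq_mul, RingHom.id_apply, mul_sum]
    refine sum_congr rfl fun σ _ => sum_congr rfl fun τ _ => by ring

lemma antisymmForm_conjDiagonal (g : Matrix n n ℝ) (hg : gᵀ * g = 1) (a : (n → n) → ℝ) :
    antisymmForm (conjDiagonal (tensorMatrix fun _ : n => g) (tensorMatrix_orthogonal hg) a)
      = ∑ ρ : n → n, a ρ * (g.submatrix id ρ).det ^ 2 := by
  have h : ∀ ρ : n → n, (g.submatrix id ρ).det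
      = ∑ σ : Equiv.Perm n, ((Equiv.Perm.sign σ : ℤ) : ℝ) * ∏ j, g (σ j) (ρ j) := by
    intro ρ
    rw [det_apply']
    rfl
  simp only [h, antisymmForm, LinearMap.coe_mk, AddHom.coe_mk, conjDiagonal_apply_apply,
    tensorMatrix_apply, mul_sum]
  rw [sum_congr rfl fun σ _ => sum_comm, sum_comm]
  refine sum_congr rfl fun ρ _ => ?_
  rw [pow_two, sum_mul_sum, mul_sum]
  refine sum_congr rfl fun σ _ => ?_
  rw [mul_sum]
  refine sum_congr rfl fun τ _ => by ring

lemma injective_of_det_submatrix_ne_zero {g : Matrix n n ℝ} {ρ : n → n}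
    (h : (g.submatrix id ρ).det ≠ 0) : Function.Injective ρ := by
  intro i j hij
  by_contra hne
  exact h (det_zero_of_column_eq hne fun k => by simp [hij])

end Tensor

section MatrixAnalytic

variable {E m n ι : Type*} [NormedAddCommGroup E] [NormedSpace ℝ E] [Fintype m]
  [Fintype n] [DecidableEq n] [Fintype ι] [DecidableEq ι]

lemma AnalyticAt.linearMap_matrix_comp {f : E → Matrix m m ℝ} {x : E} (L : Matrix m m ℝ →ₗ[ℝ] ℝ)
    (hf : AnalyticAt ℝ f x) : AnalyticAt ℝ (fun y => L (f y)) x :=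
  (L.toContinuousLinearMap.analyticAt (f x)).comp hf

lemma AnalyticAt.matrix_of_entries [DecidableEq m] {f : E → Matrix m m ℝ} {x : E}
    (hf : ∀ i j, AnalyticAt ℝ (fun y => f y i j) x) : AnalyticAt ℝ f x := by
  have h : f = fun y => ∑ i, ∑ j, f y i j • Matrix.single i j (1 : ℝ) := by
    ext1 y
    conv_lhs => rw [matrix_eq_sum_single (f y)]
    simp
  rw [h]
  exact Finset.analyticAt_fun_sum _ fun i _ => Finset.analyticAt_fun_sum _ fun j _ =>
    (hf i j).smul analyticAt_const

lemma AnalyticAt.tensorMatrix {M : ι → E → Matrix n n ℝ} {x : E}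
    (hM : ∀ j, AnalyticAt ℝ (M j) x) :
    AnalyticAt ℝ (fun y => _root_.tensorMatrix fun j => M j y) x :=
  AnalyticAt.matrix_of_entries fun σ τ => Finset.analyticAt_fun_prod _ fun j _ =>
    (hM j).linearMap_matrix_comp (Matrix.entryLinearMap ℝ ℝ (σ j) (τ j))

end MatrixAnalytic

/-- A symmetric analytic function of the eigenvalues of a symmetric matrix is locally the
restriction of an analytic function of the matrix. -/
theorem exists_analyticAt_eq_symmetric_eigenvalues {n : Type*} [Fintype n] [DecidableEq n]
    {f : (n → ℝ) → ℝ} (hsymm : ∀ (σ : Equiv.Perm n) a, f (a ∘ σ) = f a)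
    (g₀ : Matrix n n ℝ) (hg₀ : g₀ᵀ * g₀ = 1) {c : n → ℝ} (hf : AnalyticAt ℝ f c) :
    ∃ K : Matrix n n ℝ → ℝ, AnalyticAt ℝ K (conjDiagonal g₀ hg₀ c) ∧
      ∀ᶠ x in 𝓝 (conjDiagonal g₀ hg₀ c), ∀ g hg a, x = conjDiagonal g hg a → K x = f a := by
  choose P W hP hWc hPW using exists_analytic_spectral_projection g₀ hg₀ c
  have hf' : AnalyticAt ℝ (fun v => f (c + v)) 0 := by
    refine AnalyticAt.comp (g := f) (f := fun v => c + v) (by simpa using hf) ?_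
    exact analyticAt_const.add analyticAt_id
  obtain ⟨Ψ, hΨ, h⟩ := exists_analytic_matrix_calculus (n := n → n) hf'
  let b : Matrix n n ℝ → n → Matrix (n → n) (n → n) ℝ := fun x i =>
    tensorMatrix (Function.update (1 : n → Matrix n n ℝ) i ((x - c i • 1) * P i x))
  let T : Matrix n n ℝ → Matrix (n → n) (n → n) ℝ := fun x => tensorMatrix fun i => P i x
  have hba : AnalyticAt ℝ b (conjDiagonal g₀ hg₀ c) := by
    refine AnalyticAt.pi fun i => ?_
    have h1 : AnalyticAt ℝ (fun x => (x - c i • 1) * P i x) (conjDiagonal g₀ hg₀ c) :=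
      (analyticAt_id.sub analyticAt_const).mul (hP i)
    refine (AnalyticAt.tensorMatrix (M := fun j x =>
      Function.update (1 : n → Matrix n n ℝ) i ((x - c i • 1) * P i x) j) fun j => ?_)
    by_cases hj : j = i
    · subst hj
      simpa using h1
    · simpa [hj] using analyticAt_const
  have hTa : AnalyticAt ℝ T (conjDiagonal g₀ hg₀ c) := AnalyticAt.tensorMatrix hP
  have hbT : ∀ᶠ x in 𝓝 (conjDiagonal g₀ hg₀ c), ∀ g hg a, x = conjDiagonal g hg a →
      (∀ i, b x i = conjDiagonal (tensorMatrix fun _ : n => g) (tensorMatrix_orthogonal hg)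
        (fun τ => (a (τ i) - c i) * W i (a (τ i)))) ∧
      T x = conjDiagonal (tensorMatrix fun _ : n => g) (tensorMatrix_orthogonal hg)
        (fun τ => ∏ i, W i (a (τ i))) ∧
      ∀ i k, W i (a k) = 0 ∨ W i (a k) = 1 := by
    filter_upwards [eventually_all.2 hPW] with x hx g hg a hxa
    have h1 : ∀ i, P i x = conjDiagonal g hg (fun k => W i (a k)) := fun i => (hx i g hg a hxa).1
    refine ⟨fun i => ?_, ?_, fun i => (hx i g hg a hxa).2⟩
    · have h2 : (x - c i • 1) * P i x = conjDiagonal g hg (fun k => (a k - c i) * W i (a k)) := by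
        rw [h1, hxa, ← map_one (conjDiagonal g hg), ← map_smul, ← map_sub, ← map_mul]
        refine congrArg _ (funext fun k => ?_)
        simp
      simp only [b]
      rw [h2, tensorMatrix_update_conjDiagonal]
    · simp only [T, h1]
      rw [tensorMatrix_conjDiagonal]
  obtain ⟨hb0, hT0, -⟩ := hbT.self_of_nhds g₀ hg₀ c rfl
  have hb0' : b (conjDiagonal g₀ hg₀ c) = 0 := by
    ext1 i
    rw [hb0, Pi.zero_apply, ← map_zero (conjDiagonal (tensorMatrix fun _ : n => g₀)
      (tensorMatrix_orthogonal hg₀))]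
    refine congrArg _ (funext fun τ => ?_)
    rw [hWc]
    split_ifs with hc <;> simp [hc]
  have hbt : Tendsto b (𝓝 (conjDiagonal g₀ hg₀ c)) (𝓝 0) := hb0' ▸ hba.continuousAt.tendsto
  have hqa : AnalyticAt ℝ (fun x => antisymmForm (T x)) (conjDiagonal g₀ hg₀ c) :=
    hTa.linearMap_matrix_comp antisymmForm
  have hq0 : antisymmForm (T (conjDiagonal g₀ hg₀ c)) ≠ 0 := by
    rw [hT0, antisymmForm_conjDiagonal g₀ hg₀]
    have hterm : ∀ ρ ∈ (univ : Finset (n → n)),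
        0 ≤ (∏ i, W i (c (ρ i))) * (g₀.submatrix id ρ).det ^ 2 := fun ρ _ =>
      mul_nonneg (prod_nonneg fun i _ => by rw [hWc]; split_ifs <;> norm_num) (sq_nonneg _)
    refine (sum_pos' hterm ⟨id, mem_univ _, ?_⟩).ne'
    have hdet : g₀.det ≠ 0 := by
      intro h0
      have := congrArg det hg₀
      simp [h0] at this
    simp only [id_eq, hWc, if_true, prod_const_one, one_mul, submatrix_id_id]
    positivity
  refine ⟨fun x => antisymmForm (Ψ (b x) * T x) / antisymmForm (T x), ?_, ?_⟩
  · refine AnalyticAt.div (AnalyticAt.linearMap_matrix_comp antisymmForm (AnalyticAt.mul ?_ hTa))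
      hqa hq0
    exact AnalyticAt.comp (g := Ψ) (by rwa [hb0']) hba
  · filter_upwards [hbT, hbt.eventually h, hqa.continuousAt.eventually_ne hq0]
      with x hx hΨx hqx g hg a hxa
    obtain ⟨hbx, hTx, hW⟩ := hx g hg a hxa
    rw [div_eq_iff hqx, hΨx _ _ _ hbx, hTx, ← map_mul, antisymmForm_conjDiagonal g hg,
      antisymmForm_conjDiagonal g hg, mul_sum]
    refine sum_congr rfl fun ρ _ => ?_
    by_cases hdet : (g.submatrix id ρ).det = 0
    · simp [hdet]
    by_cases hall : ∀ i, W i (a (ρ i)) = 1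
    · have hρ : Function.Bijective ρ :=
        Finite.injective_iff_bijective.1 (injective_of_det_submatrix_ne_zero hdet)
      have : (c + fun i => (a (ρ i) - c i) * W i (a (ρ i))) = a ∘ Equiv.ofBijective ρ hρ := by
        ext i
        simp [hall]
      simp only [Pi.mul_apply, this, hsymm, mul_assoc]
    · push Not at hall
      obtain ⟨i, hi⟩ := hall
      have h0 : ∏ i, W i (a (ρ i)) = 0 :=
        prod_eq_zero (mem_univ i) ((hW i (ρ i)).resolve_right hi)
      simp [h0]

end RotationInvariant

/-- A rotation-invariant function on the real symmetric matrices whose restriction to the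
diagonal matrices is `real-analytic is itself real-analytic`. -/
theorem rotation_invariant_analytic_of_diagonal_restriction
    (d : ℕ) (F : SymMat d → ℝ)
    (hinv : ∀ g : Matrix (Fin d) (Fin d) ℝ, g * gᵀ = 1 →
      ∀ x y : SymMat d, (y : Matrix (Fin d) (Fin d) ℝ) = g * (x : Matrix (Fin d) (Fin d) ℝ) * gᵀ →
        F y = F x)
    (hdiag : AnalyticOnNhd ℝ (fun r : EuclideanSpace ℝ (Fin d) =>
      F ⟨Matrix.diagonal (fun i => r i), Matrix.isSymm_diagonal _⟩) Set.univ) :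
    AnalyticOnNhd ℝ F Set.univ := by
  have hf : ∀ c : Fin d → ℝ, AnalyticAt ℝ
      (fun a : Fin d → ℝ => F ⟨Matrix.diagonal a, Matrix.isSymm_diagonal _⟩) c := fun c =>
    (hdiag (WithLp.toLp 2 c) (Set.mem_univ _)).comp
      ((EuclideanSpace.equiv (Fin d) ℝ).symm.toContinuousLinearMap.analyticAt c)
  have hsymm : ∀ (σ : Equiv.Perm (Fin d)) (a : Fin d → ℝ),
      F ⟨Matrix.diagonal (a ∘ σ), Matrix.isSymm_diagonal _⟩
        = F ⟨Matrix.diagonal a, Matrix.isSymm_diagonal _⟩ := by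
    intro σ a
    refine hinv (σ.permMatrix ℝ) ?_ _ _ ?_
    · rw [Matrix.transpose_permMatrix, ← Matrix.permMatrix_mul]
      simp
    · rw [Matrix.transpose_permMatrix, PEquiv.toMatrix_toPEquiv_mul, PEquiv.mul_toMatrix_toPEquiv]
      ext i j
      simp [Matrix.diagonal_apply, Equiv.Perm.inv_def]
  intro x₀ _
  obtain ⟨g₀, hg₀, c, hc⟩ := IsSymm.exists_eq_conjDiagonal x₀.2
  obtain ⟨K, hK, hKF⟩ := exists_analyticAt_eq_symmetric_eigenvalues hsymm g₀ hg₀ (hf c)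
  rw [← hc] at hK hKF
  have hKs : AnalyticAt ℝ (fun x : SymMat d => K x) x₀ :=
    AnalyticAt.comp (g := K) hK ((SymMat d).subtypeL.analyticAt x₀)
  refine hKs.congr ?_
  have ht : Filter.Tendsto (fun x : SymMat d => (x : Matrix (Fin d) (Fin d) ℝ)) (nhds x₀)
      (nhds (x₀ : Matrix (Fin d) (Fin d) ℝ)) := continuous_subtype_val.tendsto x₀
  filter_upwards [ht.eventually hKF] with x hx
  obtain ⟨g, hg, a, ha⟩ := IsSymm.exists_eq_conjDiagonal x.2
  rw [hx g hg a ha]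
  exact (hinv g (mul_eq_one_comm.1 hg) _ _ ha).symm
end
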